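/- arXiv:1212.5099 — 2 statements merged into one kernel-verified Lean document; each statement's English description precedes it below -/
import Mathlib

section
/- For all integers m ≥ 1, n ≥ 1 and every real β with 0 ≤ β < n, the weighted integral ∫_0^∞ η^{n−1−β} f_{m,n}(η) dη is finite and strictly positive. -/
open MeasureTheory Real Filter Topology

noncomputable def besselJ (ν y : ℝ) : ℝ :=
  ∑' k : ℕ, (-1 : ℝ) ^ k * (y / 2) ^ ((2 * k : ℝ) + ν) /
    (Nat.factorial k * Real.Gamma ((k : ℝ) + ν + 1))

noncomputable def fmn (m n : ℕ) (η : ℝ) : ℝ :=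
  η ^ ((1 : ℝ) - n) *
    ∫ s in Set.Ioi (0 : ℝ),
      Real.exp (-(s ^ (2 * m))) * (η * s) ^ ((n : ℝ) / 2) *
        besselJ (((n : ℝ) - 2) / 2) (η * s)

/-- auxiliary series -/
noncomputable def Psi (a r : ℝ) : ℝ :=
  ∑' k : ℕ, (-1 : ℝ) ^ k * (r / 4) ^ k / (Nat.factorial k * Real.Gamma ((k : ℝ) + a))

lemma Gamma_lower {a : ℝ} (ha : 1 / 2 ≤ a) (k : ℕ) :
    Real.Gamma a / 2 ≤ Real.Gamma ((k : ℝ) + a) := by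
  have hG : 0 < Real.Gamma a := Real.Gamma_pos_of_pos (by linarith)
  rcases k with _ | k
  · simp; linarith
  · induction k with
    | zero =>
      have : ((0 + 1 : ℕ) : ℝ) + a = a + 1 := by push_cast; ring
      rw [this, Real.Gamma_add_one (by linarith)]
      nlinarith
    | succ k ih =>
      have : ((k + 1 + 1 : ℕ) : ℝ) + a = (((k + 1 : ℕ) : ℝ) + a) + 1 := by push_cast; ring
      have hk : (0 : ℝ) ≤ k := k.cast_nonneg
      rw [this, Real.Gamma_add_one (by push_cast; linarith)]
      have h1 : (1 : ℝ) ≤ ((k + 1 : ℕ) : ℝ) + a := by push_cast; linarith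
      nlinarith

lemma Psi_term_bound {a : ℝ} (ha : 1 / 2 ≤ a) (r : ℝ) (k : ℕ) :
    ‖(-1 : ℝ) ^ k * (r / 4) ^ k / (Nat.factorial k * Real.Gamma ((k : ℝ) + a))‖
      ≤ (2 / Real.Gamma a) * ((|r| / 4) ^ k / Nat.factorial k) := by
  have hG : 0 < Real.Gamma a := Real.Gamma_pos_of_pos (by linarith)
  have hl := Gamma_lower ha k
  have hGk : 0 < Real.Gamma ((k : ℝ) + a) := by linarith
  have hf : (0 : ℝ) < Nat.factorial k := by positivity
  rw [norm_div, norm_mul, norm_pow, norm_pow, norm_mul, norm_neg, norm_one, one_pow, one_mul,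
    Real.norm_of_nonneg hf.le, Real.norm_of_nonneg hGk.le, norm_div, Real.norm_eq_abs,
    Real.norm_of_nonneg (by norm_num : (0 : ℝ) ≤ 4)]
  calc (|r| / 4) ^ k / (Nat.factorial k * Real.Gamma ((k : ℝ) + a))
      ≤ (|r| / 4) ^ k / (Nat.factorial k * (Real.Gamma a / 2)) := by gcongr
    _ = _ := by field_simp

lemma Psi_summable {a : ℝ} (ha : 1 / 2 ≤ a) (r : ℝ) :
    Summable fun k : ℕ =>
      (-1 : ℝ) ^ k * (r / 4) ^ k / (Nat.factorial k * Real.Gamma ((k : ℝ) + a)) :=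
  Summable.of_norm_bounded ((Real.summable_pow_div_factorial _).mul_left _) (Psi_term_bound ha r)

lemma Psi_zero (a : ℝ) : Psi a 0 = 1 / Real.Gamma a := by
  unfold Psi
  rw [tsum_eq_single 0]
  · simp
  · intro k hk; simp [hk]

lemma Psi_hasDerivAt {a : ℝ} (ha : 1 / 2 ≤ a) (r : ℝ) :
    HasDerivAt (Psi a) (-(1 / 4) * Psi (a + 1) r) r := by
  have key : ∀ (x : ℝ) (k : ℕ), (-1 : ℝ) ^ (k + 1) * (((k + 1 : ℕ) : ℝ) * (x / 4) ^ k * (1 / 4)) /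
      (Nat.factorial (k + 1) * Real.Gamma (((k + 1 : ℕ) : ℝ) + a)) =
      -(1 / 4) * ((-1 : ℝ) ^ k * (x / 4) ^ k /
        (Nat.factorial k * Real.Gamma ((k : ℝ) + (a + 1)))) := by
    intro x k
    have h1 : ((k + 1 : ℕ) : ℝ) + a = (k : ℝ) + (a + 1) := by push_cast; ring
    have hG : Real.Gamma ((k : ℝ) + (a + 1)) ≠ 0 :=
      (Real.Gamma_pos_of_pos (by positivity)).ne'
    rw [h1, Nat.factorial_succ]
    push_cast
    field_simp
    ring
  let u : ℕ → ℝ := fun k => match k with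
    | 0 => 0
    | k + 1 => (1 / 4) * ((2 / Real.Gamma (a + 1)) * (((|r| + 1) / 4) ^ k / Nat.factorial k))
  have hu : Summable u := by
    rw [← summable_nat_add_iff 1]
    exact ((Real.summable_pow_div_factorial _).mul_left _).mul_left _
  have h := hasDerivAt_tsum_of_isPreconnected (u := u)
    (g := fun (k : ℕ) (x : ℝ) =>
      (-1 : ℝ) ^ k * (x / 4) ^ k / (Nat.factorial k * Real.Gamma ((k : ℝ) + a)))
    (g' := fun (k : ℕ) (x : ℝ) => (-1 : ℝ) ^ k * ((k : ℝ) * (x / 4) ^ (k - 1) * (1 / 4)) /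
      (Nat.factorial k * Real.Gamma ((k : ℝ) + a)))
    (t := Metric.ball (0 : ℝ) (|r| + 1)) (y₀ := 0) (y := r) hu Metric.isOpen_ball
    (convex_ball _ _).isPreconnected ?_ ?_ (Metric.mem_ball_self (by positivity))
    (Psi_summable ha 0) (by simp)
  · refine HasDerivAt.congr_deriv (f := Psi a) h ?_
    have hs : Summable fun k : ℕ => (-1 : ℝ) ^ k * ((k : ℝ) * (r / 4) ^ (k - 1) * (1 / 4)) /
      (Nat.factorial k * Real.Gamma ((k : ℝ) + a)) := by
      rw [← summable_nat_add_iff 1]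
      refine ((Psi_summable (a := a + 1) (by linarith) r).mul_left (-(1/4))).congr ?_
      intro k
      simpa using (key r k).symm
    rw [hs.tsum_eq_zero_add]
    simp only [Nat.add_sub_cancel, key]
    rw [tsum_mul_left]
    simp [Psi]
  · intro k x _
    have h1 : HasDerivAt (fun x : ℝ => (x / 4) ^ k) ((k : ℝ) * (x / 4) ^ (k - 1) * (1 / 4)) x :=
      ((hasDerivAt_id x).div_const 4).pow k
    exact (h1.const_mul _).div_const _
  · intro k x hx
    rcases k with _ | k
    · simp [u]
    · simp only [Nat.add_sub_cancel, key, u]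
      rw [norm_mul, norm_neg, Real.norm_of_nonneg (by norm_num : (0 : ℝ) ≤ 1 / 4)]
      refine mul_le_mul_of_nonneg_left ((Psi_term_bound (by linarith) x k).trans ?_) (by norm_num)
      have hG : 0 < Real.Gamma (a + 1) := Real.Gamma_pos_of_pos (by linarith)
      have hx' : |x| ≤ |r| + 1 := (by simpa using hx : |x| < |r| + 1).le
      gcongr

lemma Psi_rec {a : ℝ} (ha : 1 / 2 ≤ a) (r : ℝ) :
    r / 4 * Psi (a + 2) r = a * Psi (a + 1) r - Psi a r := by
  have h0 := Psi_summable ha r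
  have h1 := Psi_summable (a := a + 1) (by linarith) r
  have h2 := Psi_summable (a := a + 2) (by linarith) r
  have h3 := (h1.mul_left a).sub h0
  have e : a * Psi (a + 1) r - Psi a r = ∑' k : ℕ,
    (a * ((-1 : ℝ) ^ k * (r / 4) ^ k / (Nat.factorial k * Real.Gamma ((k : ℝ) + (a + 1)))) -
      (-1 : ℝ) ^ k * (r / 4) ^ k / (Nat.factorial k * Real.Gamma ((k : ℝ) + a))) := by
    rw [(h1.mul_left a).tsum_sub h0, tsum_mul_left]; rfl
  rw [e, h3.tsum_eq_zero_add]
  have z : (a * ((-1 : ℝ) ^ 0 * (r / 4) ^ 0 / (Nat.factorial 0 *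
      Real.Gamma (((0 : ℕ) : ℝ) + (a + 1)))) -
      (-1 : ℝ) ^ 0 * (r / 4) ^ 0 / (Nat.factorial 0 * Real.Gamma (((0 : ℕ) : ℝ) + a))) = 0 := by
    have hG : Real.Gamma a ≠ 0 := (Real.Gamma_pos_of_pos (by linarith)).ne'
    simp only [Nat.cast_zero, zero_add]
    rw [Real.Gamma_add_one (by linarith)]
    have : a ≠ 0 := by linarith
    simp
    field_simp
    ring
  rw [z, zero_add, Psi, ← tsum_mul_left]
  congr 1
  ext k
  have hk : (0 : ℝ) < k + 1 + a := by positivity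
  have e1 : ((k + 1 : ℕ) : ℝ) + (a + 1) = (k + 1 + a) + 1 := by push_cast; ring
  have e2 : (k : ℝ) + (a + 2) = (k + 1 + a) + 1 := by ring
  have e3 : ((k + 1 : ℕ) : ℝ) + a = k + 1 + a := by push_cast; ring
  have hG : Real.Gamma (k + 1 + a) ≠ 0 := (Real.Gamma_pos_of_pos hk).ne'
  rw [e1, e2, e3, Real.Gamma_add_one hk.ne', Nat.factorial_succ]
  push_cast
  field_simp
  ring

lemma Psi_continuous {a : ℝ} (ha : 1 / 2 ≤ a) : Continuous (Psi a) :=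
  continuous_iff_continuousAt.2 fun r => (Psi_hasDerivAt ha r).continuousAt

lemma Psi_bound {a : ℝ} (ha : 1 / 2 ≤ a) {r : ℝ} (hr : 0 ≤ r) : |Psi a r| ≤ 1 / Real.Gamma a := by
  have hd : ∀ x : ℝ, HasDerivAt (fun r => Psi a r ^ 2 + r / 4 * Psi (a + 1) r ^ 2)
      ((1 / 4 - a / 2) * Psi (a + 1) x ^ 2) x := by
    intro x
    have h0 := Psi_hasDerivAt ha x
    have h1 := Psi_hasDerivAt (a := a + 1) (by linarith) x
    have := (h0.pow 2).add (((hasDerivAt_id x).div_const 4).mul (h1.pow 2))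
    refine this.congr_deriv ?_
    have e := Psi_rec ha x
    rw [show a + 1 + 1 = a + 2 by ring]
    simp
    linear_combination (-1/2 * Psi (a+1) x) * e
  have hanti : AntitoneOn (fun r => Psi a r ^ 2 + r / 4 * Psi (a + 1) r ^ 2) (Set.univ) := by
    refine antitoneOn_of_deriv_nonpos convex_univ
      (fun x _ => (hd x).continuousAt.continuousWithinAt)
      (fun x _ => (hd x).differentiableAt.differentiableWithinAt) ?_
    intro x _
    rw [(hd x).deriv]
    nlinarith [sq_nonneg (Psi (a + 1) x)]
  have h := hanti (Set.mem_univ 0) (Set.mem_univ r) hr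
  have hG : 0 < Real.Gamma a := Real.Gamma_pos_of_pos (by linarith)
  simp only [Psi_zero] at h
  refine abs_le_of_sq_le_sq ?_ (by positivity)
  have : 0 ≤ r / 4 * Psi (a + 1) r ^ 2 := by positivity
  nlinarith

lemma exp_neg_pow_le {m : ℕ} (hm : 1 ≤ m) {s : ℝ} (hs : 0 ≤ s) :
    Real.exp (-(s ^ (2 * m))) ≤ Real.exp 1 * Real.exp (-s) := by
  rw [← Real.exp_add]
  apply Real.exp_le_exp.2
  rcases le_total s 1 with h | h
  · have : 0 ≤ s ^ (2 * m) := by positivity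
    linarith
  · have : s ≤ s ^ (2 * m) := le_self_pow₀ h (by omega)
    linarith

lemma poly_exp_tendsto {m : ℕ} (hm : 1 ≤ m) (P : Polynomial ℝ) :
    Tendsto (fun s : ℝ => P.eval s * Real.exp (-(s ^ (2 * m)))) atTop (𝓝 0) := by
  have h := ((Polynomial.tendsto_div_exp_atTop P).norm.const_mul (Real.exp 1))
  simp only [norm_zero, mul_zero] at h
  refine squeeze_zero_norm' ?_ h
  filter_upwards [eventually_ge_atTop 0] with s hs
  rw [norm_mul, norm_div, Real.norm_of_nonneg (Real.exp_pos (-(s ^ (2 * m)))).le,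
    Real.norm_of_nonneg (Real.exp_pos s).le]
  calc _ ≤ ‖P.eval s‖ * (Real.exp 1 * Real.exp (-s)) := by
        gcongr; exact exp_neg_pow_le hm hs
    _ = _ := by rw [Real.exp_neg]; field_simp

lemma poly_exp_integrable {m : ℕ} (hm : 1 ≤ m) (P : Polynomial ℝ) :
    IntegrableOn (fun s : ℝ => P.eval s * Real.exp (-(s ^ (2 * m)))) (Set.Ioi 0) := by
  induction P using Polynomial.induction_on' with
  | add p q hp hq =>
    refine (hp.add hq).congr_fun ?_ measurableSet_Ioi
    intro s _
    simp [add_mul]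
  | monomial k c =>
    have h := Real.GammaIntegral_convergent (s := (k : ℝ) + 1) (by positivity)
    have h2 := (h.const_mul (Real.exp 1)).const_mul |c|
    refine Integrable.mono' h2 (by fun_prop) ?_
    refine (ae_restrict_iff' measurableSet_Ioi).2 (ae_of_all _ ?_)
    intro s hs
    have hs : 0 < s := hs
    simp only [Polynomial.eval_monomial]
    rw [norm_mul, norm_mul, norm_pow, Real.norm_of_nonneg (Real.exp_pos (-(s ^ (2 * m)))).le,
      Real.norm_of_nonneg hs.le, Real.norm_eq_abs, add_sub_cancel_right, Real.rpow_natCast]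
    have := exp_neg_pow_le hm hs.le
    calc |c| * s ^ k * Real.exp (-(s ^ (2 * m))) ≤ |c| * s ^ k * (Real.exp 1 * Real.exp (-s)) := by
          gcongr
      _ = _ := by ring

/-- derivative operator on the polynomial factor -/
noncomputable def DQ (m : ℕ) (Q : Polynomial ℝ) : Polynomial ℝ :=
  Polynomial.derivative Q - Polynomial.C (m : ℝ) * Polynomial.X ^ (m - 1) * Q

noncomputable def FQ (m n : ℕ) (Q : Polynomial ℝ) (η : ℝ) : ℝ :=
  ∫ s in Set.Ioi (0 : ℝ), s ^ (n - 1) * Q.eval (s ^ 2) * Real.exp (-(s ^ (2 * m))) *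
    Psi ((n : ℝ) / 2) (η ^ 2 * s ^ 2)

noncomputable def LQ (m n : ℕ) (Q : Polynomial ℝ) : Polynomial ℝ :=
  Polynomial.C (2 * (n : ℝ)) * DQ m Q + Polynomial.C 4 * Polynomial.X * DQ m (DQ m Q)

lemma half_le {n : ℕ} (hn : 1 ≤ n) : (1 : ℝ) / 2 ≤ (n : ℝ) / 2 := by
  have : (1 : ℝ) ≤ n := by exact_mod_cast hn
  linarith

lemma FQ_poly (m : ℕ) (k : ℕ) (Q : Polynomial ℝ) (s : ℝ) :
    s ^ k * Q.eval (s ^ 2) * Real.exp (-(s ^ (2 * m))) =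
    (Polynomial.X ^ k * Q.comp (Polynomial.X ^ 2)).eval s * Real.exp (-(s ^ (2 * m))) := by
  simp

lemma FQ_integrable0 {m : ℕ} (hm : 1 ≤ m) (k : ℕ) (Q : Polynomial ℝ) :
    IntegrableOn (fun s : ℝ => s ^ k * Q.eval (s ^ 2) * Real.exp (-(s ^ (2 * m))))
      (Set.Ioi 0) := by
  simp only [FQ_poly m]
  exact poly_exp_integrable hm _

lemma FQ_integrable {m n : ℕ} (hm : 1 ≤ m) (hn : 1 ≤ n) (Q : Polynomial ℝ) (η : ℝ) :
    IntegrableOn (fun s : ℝ => s ^ (n - 1) * Q.eval (s ^ 2) * Real.exp (-(s ^ (2 * m))) *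
      Psi ((n : ℝ) / 2) (η ^ 2 * s ^ 2)) (Set.Ioi 0) := by
  refine (FQ_integrable0 hm (n - 1) Q).mul_bdd (c := 1 / Real.Gamma ((n : ℝ) / 2)) ?_ ?_
  · have := Psi_continuous (half_le hn)
    exact Continuous.aestronglyMeasurable (by fun_prop)
  · exact ae_of_all _ fun s => Psi_bound (half_le hn) (by positivity)

lemma exp_pow_hasDerivAt (m : ℕ) (Q : Polynomial ℝ) (r : ℝ) :
    HasDerivAt (fun r : ℝ => Q.eval r * Real.exp (-(r ^ m)))
      ((DQ m Q).eval r * Real.exp (-(r ^ m))) r := by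
  have h := (Q.hasDerivAt r).mul ((hasDerivAt_pow m r).neg.exp)
  refine h.congr_deriv ?_
  simp [DQ]
  ring

lemma FQ_step {m n : ℕ} (hm : 1 ≤ m) (hn : 1 ≤ n) (Q : Polynomial ℝ) (η : ℝ) :
    η ^ 2 * FQ m n Q η = - FQ m n (LQ m n Q) η := by
  set a : ℝ := (n : ℝ) / 2 with ha_def
  have ha : 1 / 2 ≤ a := half_le hn
  let K : ℝ → ℝ := fun r => -(η ^ 2 / 2) * (Q.eval r * Real.exp (-(r ^ m)) * Psi (a + 1) (η ^ 2 * r))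
    - 2 * ((DQ m Q).eval r * Real.exp (-(r ^ m)) * Psi a (η ^ 2 * r))
  have hK : ∀ r, HasDerivAt K (Real.exp (-(r ^ m)) * (η ^ 4 / 8 * Q.eval r * Psi (a + 2) (η ^ 2 * r)
      - 2 * (DQ m (DQ m Q)).eval r * Psi a (η ^ 2 * r))) r := by
    intro r
    have hl : HasDerivAt (fun r : ℝ => η ^ 2 * r) (η ^ 2) r := by
      simpa using (hasDerivAt_id r).const_mul (η ^ 2)
    have p0 := (Psi_hasDerivAt ha (η ^ 2 * r)).comp r hl
    have p1 := (Psi_hasDerivAt (a := a + 1) (by linarith) (η ^ 2 * r)).comp r hl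
    have := (((exp_pow_hasDerivAt m Q r).mul p1).const_mul (-(η ^ 2 / 2))).sub
      (((exp_pow_hasDerivAt m (DQ m Q) r).mul p0).const_mul 2)
    refine HasDerivAt.congr_deriv (f := K) this ?_
    rw [show a + 1 + 1 = a + 2 by ring]
    simp only [Function.comp]
    ring
  let H : ℝ → ℝ := fun s => s ^ n * K (s ^ 2)
  have hH : ∀ s, HasDerivAt H (-η ^ 2 * (s ^ (n - 1) * Q.eval (s ^ 2) * Real.exp (-(s ^ (2 * m))) *
      Psi a (η ^ 2 * s ^ 2)) - s ^ (n - 1) * (LQ m n Q).eval (s ^ 2) * Real.exp (-(s ^ (2 * m))) *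
      Psi a (η ^ 2 * s ^ 2)) s := by
    intro s
    have := (hasDerivAt_pow n s).mul ((hK (s ^ 2)).comp s (hasDerivAt_pow 2 s))
    refine HasDerivAt.congr_deriv (f := H) this ?_
    have e := Psi_rec ha (η ^ 2 * s ^ 2)
    obtain ⟨k, rfl⟩ : ∃ k, n = k + 1 := ⟨n - 1, by omega⟩
    have hna : ((k + 1 : ℕ) : ℝ) = 2 * a := by rw [ha_def]; ring
    simp only [Function.comp, K, LQ, pow_mul, Nat.add_sub_cancel, Polynomial.eval_add,
      Polynomial.eval_mul, Polynomial.eval_C, Polynomial.eval_X, hna]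
    simp only [show (2 : ℕ) - 1 = 1 from rfl, pow_one]
    clear_value a
    linear_combination (s ^ k * Real.exp (-(s ^ 2) ^ m) * η ^ 2 * Q.eval (s ^ 2)) * e
  have hlim : Tendsto H atTop (𝓝 0) := by
    have t1 := poly_exp_tendsto hm (Polynomial.X ^ n * Q.comp (Polynomial.X ^ 2))
    have t2 := poly_exp_tendsto hm (Polynomial.X ^ n * (DQ m Q).comp (Polynomial.X ^ 2))
    simp only [← FQ_poly m] at t1 t2
    have b0 : ∀ s : ℝ, ‖Psi a (η ^ 2 * s ^ 2)‖ ≤ 1 / Real.Gamma a :=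
      fun s => Psi_bound ha (by positivity)
    have b1 : ∀ s : ℝ, ‖Psi (a + 1) (η ^ 2 * s ^ 2)‖ ≤ 1 / Real.Gamma (a + 1) :=
      fun s => Psi_bound (by linarith) (by positivity)
    have u1 := t1.zero_mul_isBoundedUnder_le (isBoundedUnder_of ⟨_, b1⟩)
    have u2 := t2.zero_mul_isBoundedUnder_le (isBoundedUnder_of ⟨_, b0⟩)
    have := (u1.const_mul (-(η ^ 2 / 2))).sub (u2.const_mul 2)
    simp only [mul_zero, sub_zero] at this
    refine this.congr fun s => ?_
    simp only [H, K, pow_mul]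
    ring
  have i1 := FQ_integrable hm hn Q η
  have i2 := FQ_integrable hm hn (LQ m n Q) η
  have hI := integral_Ioi_of_hasDerivAt_of_tendsto (a := 0) (hH 0).continuousAt.continuousWithinAt
    (fun s _ => hH s) ((i1.const_mul _).sub i2) hlim
  rw [integral_sub (i1.const_mul _) i2, integral_const_mul] at hI
  have h0 : H 0 = 0 := by simp [H, show n ≠ 0 by omega]
  rw [h0] at hI
  unfold FQ
  linarith

lemma FQ_decay {m n : ℕ} (hm : 1 ≤ m) (hn : 1 ≤ n) (j : ℕ) : ∀ (Q : Polynomial ℝ),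
    ∃ C, ∀ η : ℝ, (η ^ 2) ^ j * |FQ m n Q η| ≤ C := by
  induction j with
  | zero =>
    intro Q
    refine ⟨∫ s in Set.Ioi (0 : ℝ), ‖s ^ (n - 1) * Q.eval (s ^ 2) * Real.exp (-(s ^ (2 * m)))‖ *
      (1 / Real.Gamma ((n : ℝ) / 2)), fun η => ?_⟩
    rw [pow_zero, one_mul, FQ, ← Real.norm_eq_abs]
    refine norm_integral_le_of_norm_le ((FQ_integrable0 hm (n - 1) Q).norm.mul_const _) ?_
    refine ae_of_all _ fun s => ?_
    rw [norm_mul]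
    gcongr
    exact Psi_bound (half_le hn) (by positivity)
  | succ j ih =>
    intro Q
    obtain ⟨C, hC⟩ := ih (LQ m n Q)
    refine ⟨C, fun η => ?_⟩
    have := hC η
    rw [← abs_neg, ← FQ_step hm hn, abs_mul, abs_of_nonneg (sq_nonneg η)] at this
    rw [pow_succ, mul_assoc]
    exact this

lemma gauss_moment {q t : ℝ} (hq : -1 < q) (ht : 0 < t) :
    ∫ x in Set.Ioi (0 : ℝ), x ^ q * Real.exp (-t * x ^ 2) =
      t ^ (-(q + 1) / 2) * (1 / 2) * Real.Gamma ((q + 1) / 2) := by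
  have := integral_rpow_mul_exp_neg_mul_rpow (p := 2) (by norm_num) hq ht
  rw [← this]
  refine setIntegral_congr_fun measurableSet_Ioi fun x _ => ?_
  norm_num

lemma gauss_Psi {n : ℕ} (hn : 1 ≤ n) {t : ℝ} (ht : 0 < t) (s : ℝ) :
    ∫ η in Set.Ioi (0 : ℝ), η ^ (n - 1) * Real.exp (-t * η ^ 2) *
      Psi ((n : ℝ) / 2) (η ^ 2 * s ^ 2) =
    1 / 2 * t ^ (-((n : ℝ) / 2)) * Real.exp (-(s ^ 2 / (4 * t))) := by
  set a : ℝ := (n : ℝ) / 2 with ha_def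
  have ha : 1 / 2 ≤ a := half_le hn
  let c : ℕ → ℝ := fun k => (-1 : ℝ) ^ k * (s ^ 2 / 4) ^ k /
    (Nat.factorial k * Real.Gamma ((k : ℝ) + a))
  let G : ℕ → ℝ → ℝ := fun k η => c k * (η ^ (2 * a - 1 + 2 * k) * Real.exp (-t * η ^ 2))
  have hq : ∀ k : ℕ, -1 < 2 * a - 1 + 2 * k := fun k => by
    have : (0 : ℝ) ≤ k := k.cast_nonneg
    linarith
  have hGint : ∀ k, Integrable (G k) (volume.restrict (Set.Ioi 0)) := fun k =>
    (integrableOn_rpow_mul_exp_neg_mul_sq ht (hq k)).const_mul _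
  have hmom : ∀ k : ℕ, ∫ x in Set.Ioi (0 : ℝ), x ^ (2 * a - 1 + 2 * k) * Real.exp (-t * x ^ 2) =
      1 / 2 * t ^ (-a) * ((t⁻¹) ^ k * Real.Gamma (k + a)) := by
    intro k
    rw [gauss_moment (hq k) ht, show -(2 * a - 1 + 2 * (k : ℝ) + 1) / 2 = -a + -(k : ℝ) by ring,
      show (2 * a - 1 + 2 * (k : ℝ) + 1) / 2 = k + a by ring, Real.rpow_add ht,
      Real.rpow_neg ht.le (k : ℝ), Real.rpow_natCast, inv_pow]
    ring
  have hGk : ∀ k : ℕ, 0 < Real.Gamma ((k : ℝ) + a) := fun k =>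
    Real.Gamma_pos_of_pos (by positivity)
  have hnorm : ∀ k, ∫ x in Set.Ioi (0 : ℝ), ‖G k x‖ =
      1 / 2 * t ^ (-a) * ((s ^ 2 / (4 * t)) ^ k / Nat.factorial k) := by
    intro k
    have : ∫ x in Set.Ioi (0 : ℝ), ‖G k x‖ = ∫ x in Set.Ioi (0 : ℝ),
        ‖c k‖ * (x ^ (2 * a - 1 + 2 * k) * Real.exp (-t * x ^ 2)) := by
      refine setIntegral_congr_fun measurableSet_Ioi fun x hx => ?_
      have hx : 0 < x := hx
      simp only [G]
      rw [norm_mul]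
      congr 1
      exact Real.norm_of_nonneg (by positivity)
    rw [this, integral_const_mul, hmom]
    simp only [c]
    have h := hGk k
    rw [norm_div, norm_mul, norm_pow, norm_neg, norm_one, one_pow, one_mul,
      Real.norm_of_nonneg (by positivity), Real.norm_of_nonneg (by positivity),
      show s ^ 2 / (4 * t) = s ^ 2 / 4 * t⁻¹ by field_simp, mul_pow]
    field_simp
  have hval : ∀ k, ∫ x in Set.Ioi (0 : ℝ), G k x =
      1 / 2 * t ^ (-a) * ((-(s ^ 2 / (4 * t))) ^ k / Nat.factorial k) := by
    intro k
    simp only [G]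
    rw [integral_const_mul, hmom, neg_pow]
    have h := hGk k
    simp only [c]
    rw [show s ^ 2 / (4 * t) = s ^ 2 / 4 * t⁻¹ by field_simp, mul_pow]
    field_simp
  have hs := hasSum_integral_of_summable_integral_norm hGint (by
    simp only [hnorm]
    exact (Real.summable_pow_div_factorial _).mul_left _)
  simp only [hval] at hs
  have hs2 := (NormedSpace.expSeries_div_hasSum_exp (-(s ^ 2 / (4 * t)))).mul_left
    (1 / 2 * t ^ (-a))
  rw [← Real.exp_eq_exp_ℝ] at hs2
  rw [← hs.unique hs2]
  refine setIntegral_congr_fun measurableSet_Ioi fun x hx => ?_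
  have hx : 0 < x := hx
  simp only [Psi]
  rw [← tsum_mul_left]
  refine tsum_congr fun k => ?_
  simp only [G, c]
  have e : x ^ (2 * a - 1 + 2 * (k : ℝ)) = x ^ (n - 1) * (x ^ 2) ^ k := by
    rw [← pow_mul, ← pow_add, ← Real.rpow_natCast]
    congr 1
    push_cast [Nat.cast_sub hn]
    rw [ha_def]; ring
  rw [e, show x ^ 2 * s ^ 2 / 4 = x ^ 2 * (s ^ 2 / 4) by ring, mul_pow]
  ring

lemma FQ_measurable (m : ℕ) {n : ℕ} (hn : 1 ≤ n) (Q : Polynomial ℝ) :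
    StronglyMeasurable (FQ m n Q) := by
  unfold FQ
  apply StronglyMeasurable.integral_prod_right
  have := Psi_continuous (half_le hn)
  exact Continuous.stronglyMeasurable (by unfold Function.uncurry; fun_prop)

lemma FQ_weighted_integrable {m n : ℕ} (hm : 1 ≤ m) (hn : 1 ≤ n) (Q : Polynomial ℝ)
    {β : ℝ} (hβ0 : 0 ≤ β) (hβn : β < n) :
    IntegrableOn (fun η : ℝ => η ^ ((n : ℝ) - 1 - β) * FQ m n Q η) (Set.Ioi 0) := by
  have hmeas : ∀ μ : Measure ℝ, AEStronglyMeasurable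
      (fun η : ℝ => η ^ ((n : ℝ) - 1 - β) * FQ m n Q η) μ := fun μ =>
    (Measurable.mul (by fun_prop) (FQ_measurable m hn Q).measurable).aestronglyMeasurable
  rw [← Set.Ioc_union_Ioi_eq_Ioi (zero_le_one (α := ℝ))]
  refine IntegrableOn.union ?_ ?_
  · obtain ⟨C, hC⟩ := FQ_decay hm hn 0 Q
    have h : IntegrableOn (fun η : ℝ => η ^ ((n : ℝ) - 1 - β)) (Set.Ioc 0 1) := by
      rw [← intervalIntegrable_iff_integrableOn_Ioc_of_le zero_le_one]
      exact intervalIntegral.intervalIntegrable_rpow' (by linarith)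
    refine Integrable.mono' (h.mul_const C) (hmeas _) ?_
    refine (ae_restrict_iff' measurableSet_Ioc).2 (ae_of_all _ fun η hη => ?_)
    rw [norm_mul, Real.norm_of_nonneg (Real.rpow_nonneg hη.1.le _)]
    have := hC η
    rw [pow_zero, one_mul] at this
    exact mul_le_mul_of_nonneg_left this (Real.rpow_nonneg hη.1.le _)
  · obtain ⟨C, hC⟩ := FQ_decay hm hn n Q
    have h : IntegrableOn (fun η : ℝ => η ^ (-(n : ℝ) - 1 - β)) (Set.Ioi 1) := by
      refine integrableOn_Ioi_rpow_of_lt ?_ one_pos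
      have : (1 : ℝ) ≤ n := by exact_mod_cast hn
      linarith
    refine Integrable.mono' (h.mul_const C) (hmeas _) ?_
    refine (ae_restrict_iff' measurableSet_Ioi).2 (ae_of_all _ fun η hη => ?_)
    have hη0 : 0 < η := one_pos.trans hη
    rw [norm_mul, Real.norm_of_nonneg (Real.rpow_nonneg hη0.le _)]
    have e : η ^ ((n : ℝ) - 1 - β) = η ^ (-(n : ℝ) - 1 - β) * (η ^ 2) ^ n := by
      rw [← pow_mul, ← Real.rpow_natCast, ← Real.rpow_add hη0]
      congr 1
      push_cast; ring
    rw [e, mul_assoc]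
    exact mul_le_mul_of_nonneg_left (hC η) (Real.rpow_nonneg hη0.le _)

lemma FQ_gauss {m n : ℕ} (hm : 1 ≤ m) (hn : 1 ≤ n) {t : ℝ} (ht : 0 < t) :
    ∫ η in Set.Ioi (0 : ℝ), η ^ (n - 1) * Real.exp (-t * η ^ 2) * FQ m n 1 η =
    ∫ s in Set.Ioi (0 : ℝ), s ^ (n - 1) * Real.exp (-(s ^ (2 * m))) *
      (1 / 2 * t ^ (-((n : ℝ) / 2)) * Real.exp (-(s ^ 2 / (4 * t)))) := by
  have hPc := Psi_continuous (half_le hn)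
  have hg : IntegrableOn (fun η : ℝ => η ^ (n - 1) * Real.exp (-t * η ^ 2)) (Set.Ioi 0) := by
    have := integrableOn_rpow_mul_exp_neg_mul_sq ht (s := ((n - 1 : ℕ) : ℝ))
      (by have : (0 : ℝ) ≤ ((n - 1 : ℕ) : ℝ) := Nat.cast_nonneg _
          linarith)
    simpa only [Real.rpow_natCast] using this
  have hs := FQ_integrable0 hm (n - 1) 1
  have hint : Integrable (Function.uncurry fun (η s : ℝ) =>
      (η ^ (n - 1) * Real.exp (-t * η ^ 2)) *
      (s ^ (n - 1) * (1 : Polynomial ℝ).eval (s ^ 2) * Real.exp (-(s ^ (2 * m)))) *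
      Psi ((n : ℝ) / 2) (η ^ 2 * s ^ 2))
      ((volume.restrict (Set.Ioi 0)).prod (volume.restrict (Set.Ioi 0))) := by
    refine (hg.mul_prod hs).mul_bdd (c := 1 / Real.Gamma ((n : ℝ) / 2)) ?_ ?_
    · exact Continuous.aestronglyMeasurable (by fun_prop)
    · exact ae_of_all _ fun s => Psi_bound (half_le hn) (by positivity)
  have hswap := integral_integral_swap hint
  refine Eq.trans (Eq.trans ?_ hswap) ?_
  · refine integral_congr_ae (ae_of_all _ fun η => ?_)
    simp only [FQ]
    rw [← integral_const_mul]
    simp only [mul_assoc]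
  · refine integral_congr_ae (ae_of_all _ fun s => ?_)
    simp only
    rw [← gauss_Psi hn ht, ← integral_const_mul]
    congr 1
    ext η
    simp only [Polynomial.eval_one]
    ring

lemma integral_Ioi_pos {f : ℝ → ℝ} (hf : IntegrableOn f (Set.Ioi 0))
    (hpos : ∀ x, 0 < x → 0 < f x) : 0 < ∫ x in Set.Ioi (0 : ℝ), f x := by
  rw [setIntegral_pos_iff_support_of_nonneg_ae _ hf]
  · have : Function.support f ∩ Set.Ioi 0 = Set.Ioi 0 :=
      Set.inter_eq_right.2 fun x hx => (hpos x hx).ne'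
    rw [this]
    simp
  · exact (ae_restrict_iff' measurableSet_Ioi).2 (ae_of_all _ fun x hx => (hpos x hx).le)

lemma g_integrable {m : ℕ} (hm : 1 ≤ m) (k : ℕ) {t : ℝ} (ht : 0 < t) :
    IntegrableOn (fun s : ℝ => s ^ k * Real.exp (-(s ^ (2 * m))) * Real.exp (-(s ^ 2 / t)))
      (Set.Ioi 0) := by
  have h := FQ_integrable0 hm k 1
  simp only [Polynomial.eval_one, mul_one] at h
  refine h.mul_bdd (c := 1) (Continuous.aestronglyMeasurable (by fun_prop)) ?_
  refine ae_of_all _ fun s => ?_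
  rw [Real.norm_of_nonneg (Real.exp_pos _).le]
  apply Real.exp_le_one_iff.2
  have : 0 ≤ s ^ 2 / t := by positivity
  linarith

lemma FQ_gauss_pos {m n : ℕ} (hm : 1 ≤ m) (hn : 1 ≤ n) {t : ℝ} (ht : 0 < t) :
    0 < ∫ η in Set.Ioi (0 : ℝ), η ^ (n - 1) * Real.exp (-t * η ^ 2) * FQ m n 1 η := by
  rw [FQ_gauss hm hn ht]
  apply integral_Ioi_pos
  · refine IntegrableOn.congr_fun ((g_integrable hm (n - 1) (t := 4 * t) (by positivity)).const_mul
      (1 / 2 * t ^ (-((n : ℝ) / 2)))) ?_ measurableSet_Ioi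
    intro s _
    simp only
    ring
  · intro s hs
    positivity

lemma FQ_gauss_lower {m n : ℕ} (hm : 1 ≤ m) (hn : 1 ≤ n) : ∃ c, 0 < c ∧ ∀ t : ℝ, 0 < t → t ≤ 1 →
    c ≤ ∫ η in Set.Ioi (0 : ℝ), η ^ (n - 1) * Real.exp (-t * η ^ 2) * FQ m n 1 η := by
  refine ⟨1 / 2 * ∫ u in Set.Ioi (0 : ℝ), u ^ (n - 1) * Real.exp (-(u ^ (2 * m))) *
    Real.exp (-(u ^ 2 / 4)), ?_, ?_⟩
  · refine mul_pos (by norm_num) (integral_Ioi_pos (g_integrable hm _ (by norm_num)) ?_)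
    intro x hx
    positivity
  · intro t ht ht1
    rw [FQ_gauss hm hn ht]
    set b := Real.sqrt t with hb
    have hb0 : 0 < b := Real.sqrt_pos.2 ht
    have hb1 : b ≤ 1 := Real.sqrt_le_one.2 ht1
    have hbt : b ^ 2 = t := Real.sq_sqrt ht.le
    have htn : t ^ (-((n : ℝ) / 2)) * b ^ n = 1 := by
      rw [← hbt, ← Real.rpow_natCast b 2, ← Real.rpow_mul hb0.le, ← Real.rpow_natCast b n,
        ← Real.rpow_add hb0]
      rw [show ((2 : ℕ) : ℝ) * (-((n : ℝ) / 2)) + n = 0 by push_cast; ring, Real.rpow_zero]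
    set G : ℝ → ℝ := fun s => s ^ (n - 1) * Real.exp (-(s ^ (2 * m))) *
      (1 / 2 * t ^ (-((n : ℝ) / 2)) * Real.exp (-(s ^ 2 / (4 * t)))) with hG
    have hGi : IntegrableOn G (Set.Ioi 0) := by
      refine IntegrableOn.congr_fun ((g_integrable hm (n - 1) (t := 4 * t) (by positivity)).const_mul
        (1 / 2 * t ^ (-((n : ℝ) / 2)))) ?_ measurableSet_Ioi
      intro s _
      simp only [hG]
      ring
    have hsub := integral_comp_mul_left_Ioi G 0 hb0
    have hGi2 : IntegrableOn (fun u => G (b * u)) (Set.Ioi 0) := by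
      rw [integrableOn_Ioi_comp_mul_left_iff G 0 hb0]
      simpa using hGi
    rw [mul_zero, smul_eq_mul] at hsub
    have : ∫ s in Set.Ioi (0 : ℝ), G s = b * ∫ u in Set.Ioi (0 : ℝ), G (b * u) := by
      rw [hsub]; field_simp
    rw [this, ← integral_const_mul, ← integral_const_mul]
    refine setIntegral_mono_on ((g_integrable hm _ (by norm_num)).const_mul _)
      (hGi2.const_mul _) measurableSet_Ioi ?_
    intro u hu
    have hu : 0 < u := hu
    have e1 : (b * u) ^ 2 / (4 * t) = u ^ 2 / 4 := by
      rw [mul_pow, hbt]; field_simp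
    have e2 : b ^ n = b * b ^ (n - 1) := by
      rw [← pow_succ', Nat.sub_add_cancel hn]
    have e3 : (b * u) ^ (2 * m) ≤ u ^ (2 * m) := by
      gcongr
      nlinarith
    have e4 : b * G (b * u) = 1 / 2 * (u ^ (n - 1) * Real.exp (-((b * u) ^ (2 * m))) *
        Real.exp (-(u ^ 2 / 4))) := by
      simp only [hG, e1]
      rw [mul_pow b u (n - 1)]
      rw [e2] at htn
      linear_combination (1 / 2 * (u ^ (n - 1) * Real.exp (-((b * u) ^ (2 * m))) *
        Real.exp (-(u ^ 2 / 4)))) * htn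
    rw [e4]
    gcongr

lemma pow_pred_eq {n : ℕ} (hn : 1 ≤ n) (η : ℝ) : η ^ (n - 1) = η ^ ((n : ℝ) - 1) := by
  rw [← Real.rpow_natCast, Nat.cast_sub hn, Nat.cast_one]

lemma FQ_pos_zero {m n : ℕ} (hm : 1 ≤ m) (hn : 1 ≤ n) :
    0 < ∫ η in Set.Ioi (0 : ℝ), η ^ ((n : ℝ) - 1) * FQ m n 1 η := by
  obtain ⟨c, hc, h⟩ := FQ_gauss_lower hm hn
  have hi := FQ_weighted_integrable hm hn 1 (β := 0) le_rfl (by exact_mod_cast hn)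
  simp only [sub_zero] at hi
  have hlim : Tendsto (fun t : ℝ => ∫ η in Set.Ioi (0 : ℝ), η ^ (n - 1) * Real.exp (-t * η ^ 2) *
      FQ m n 1 η) (𝓝[>] 0) (𝓝 (∫ η in Set.Ioi (0 : ℝ), η ^ ((n : ℝ) - 1) * FQ m n 1 η)) := by
    refine tendsto_integral_filter_of_dominated_convergence _ ?_ ?_ hi.norm ?_
    · refine Eventually.of_forall fun t => ?_
      exact (Measurable.mul (by fun_prop) (FQ_measurable m hn 1).measurable).aestronglyMeasurable
    · filter_upwards [self_mem_nhdsWithin] with t ht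
      have ht : 0 < t := ht
      refine ae_of_all _ fun η => ?_
      rw [norm_mul, norm_mul, norm_mul, ← pow_pred_eq hn, Real.norm_of_nonneg (Real.exp_pos _).le]
      have : Real.exp (-t * η ^ 2) ≤ 1 := Real.exp_le_one_iff.2 (by nlinarith [sq_nonneg η])
      calc _ ≤ ‖η ^ (n - 1)‖ * 1 * ‖FQ m n 1 η‖ := by gcongr
        _ = _ := by ring
    · refine ae_of_all _ fun η => ?_
      have : Continuous fun t : ℝ => η ^ (n - 1) * Real.exp (-t * η ^ 2) * FQ m n 1 η := by fun_prop
      have := (this.tendsto 0).mono_left (nhdsWithin_le_nhds (s := Set.Ioi 0))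
      simpa [pow_pred_eq hn] using this
  refine hc.trans_le (ge_of_tendsto hlim ?_)
  filter_upwards [Ioc_mem_nhdsGT (zero_lt_one (α := ℝ))] with t ht
  exact h t ht.1 ht.2

lemma FQ_pos_pos {m n : ℕ} (hm : 1 ≤ m) (hn : 1 ≤ n) {β : ℝ} (hβ : 0 < β) (hβn : β < n) :
    0 < ∫ η in Set.Ioi (0 : ℝ), η ^ ((n : ℝ) - 1 - β) * FQ m n 1 η := by
  have hi := FQ_weighted_integrable hm hn 1 hβ.le hβn
  have hΓ : 0 < Real.Gamma (β / 2) := Real.Gamma_pos_of_pos (by positivity)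
  let h : ℝ → ℝ → ℝ := fun η t => (η ^ (n - 1) * FQ m n 1 η) *
    (t ^ (β / 2 - 1) * Real.exp (-(η ^ 2 * t)))
  have hint0 : ∀ η : ℝ, 0 < η → ∫ t in Set.Ioi (0 : ℝ), t ^ (β / 2 - 1) * Real.exp (-(η ^ 2 * t)) =
      η ^ (-β) * Real.Gamma (β / 2) := by
    intro η hη
    rw [Real.integral_rpow_mul_exp_neg_mul_Ioi (by positivity) (by positivity)]
    congr 1
    rw [one_div, Real.inv_rpow (by positivity), ← Real.rpow_natCast, ← Real.rpow_mul hη.le,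
      ← Real.rpow_neg hη.le]
    congr 1
    push_cast; ring
  have hrw : ∀ η : ℝ, 0 < η → η ^ (n - 1) * η ^ (-β) = η ^ ((n : ℝ) - 1 - β) := by
    intro η hη
    rw [pow_pred_eq hn, ← Real.rpow_add hη]
    congr 1
  have hhint : Integrable (Function.uncurry h)
      ((volume.restrict (Set.Ioi 0)).prod (volume.restrict (Set.Ioi 0))) := by
    rw [integrable_prod_iff]
    · constructor
      · refine (ae_restrict_iff' measurableSet_Ioi).2 (ae_of_all _ fun η hη => ?_)
        have hη : 0 < η := hη
        have := integrableOn_rpow_mul_exp_neg_mul_rpow (s := β / 2 - 1) (p := 1) (b := η ^ 2)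
          (by linarith) one_pos (by positivity)
        simp only [Real.rpow_one, neg_mul] at this
        exact Integrable.const_mul this (η ^ (n - 1) * FQ m n 1 η)
      · refine (hi.norm.mul_const (Real.Gamma (β / 2))).congr ?_
        refine (ae_restrict_iff' measurableSet_Ioi).2 (ae_of_all _ fun η hη => ?_)
        have hη : 0 < η := hη
        have : ∫ t in Set.Ioi (0 : ℝ), ‖h η t‖ = ∫ t in Set.Ioi (0 : ℝ),
            ‖η ^ (n - 1) * FQ m n 1 η‖ * (t ^ (β / 2 - 1) * Real.exp (-(η ^ 2 * t))) := by
          refine setIntegral_congr_fun measurableSet_Ioi fun t ht => ?_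
          have ht : 0 < t := ht
          simp only [h]
          rw [norm_mul]
          congr 1
          exact Real.norm_of_nonneg (by positivity)
        simp only [Function.uncurry]
        rw [this, integral_const_mul, hint0 η hη, norm_mul, norm_mul, ← hrw η hη, norm_mul,
          Real.norm_of_nonneg (Real.rpow_nonneg hη.le (-β))]
        ring
    · have := (FQ_measurable m hn 1).measurable
      exact Measurable.aestronglyMeasurable (by unfold Function.uncurry; fun_prop)
  have hswap := integral_integral_swap hhint
  have hL : ∫ η in Set.Ioi (0 : ℝ), ∫ t in Set.Ioi (0 : ℝ), h η t =
      Real.Gamma (β / 2) * ∫ η in Set.Ioi (0 : ℝ), η ^ ((n : ℝ) - 1 - β) * FQ m n 1 η := by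
    rw [← integral_const_mul]
    refine setIntegral_congr_fun measurableSet_Ioi fun η hη => ?_
    simp only [h]
    rw [integral_const_mul, hint0 η hη, ← hrw η hη]
    ring
  have hR : 0 < ∫ t in Set.Ioi (0 : ℝ), ∫ η in Set.Ioi (0 : ℝ), h η t := by
    refine integral_Ioi_pos hhint.integral_prod_right ?_
    intro t ht
    have : ∫ η in Set.Ioi (0 : ℝ), h η t = t ^ (β / 2 - 1) *
        ∫ η in Set.Ioi (0 : ℝ), η ^ (n - 1) * Real.exp (-t * η ^ 2) * FQ m n 1 η := by
      rw [← integral_const_mul]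
      congr 1
      ext η
      simp only [h]
      rw [show -(η ^ 2 * t) = -t * η ^ 2 by ring]
      ring
    rw [this]
    exact mul_pos (Real.rpow_pos_of_pos ht _) (FQ_gauss_pos hm hn ht)
  rw [← hswap, hL] at hR
  exact pos_of_mul_pos_right hR hΓ.le

lemma fmn_eq {m n : ℕ} (hn : 1 ≤ n) {η : ℝ} (hη : 0 < η) :
    fmn m n η = (2 : ℝ) ^ (1 - (n : ℝ) / 2) * FQ m n 1 η := by
  unfold fmn FQ
  rw [← integral_const_mul, ← integral_const_mul]
  refine setIntegral_congr_fun measurableSet_Ioi fun s hs => ?_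
  have hs : 0 < s := hs
  have hy : 0 < η * s := mul_pos hη hs
  have hJ : besselJ (((n : ℝ) - 2) / 2) (η * s) =
      (η * s / 2) ^ ((n : ℝ) / 2 - 1) * Psi ((n : ℝ) / 2) (η ^ 2 * s ^ 2) := by
    unfold besselJ Psi
    rw [← tsum_mul_left]
    refine tsum_congr fun k => ?_
    rw [show (k : ℝ) + ((n : ℝ) - 2) / 2 + 1 = k + (n : ℝ) / 2 by ring,
      show 2 * (k : ℝ) + ((n : ℝ) - 2) / 2 = ((n : ℝ) / 2 - 1) + ((2 * k : ℕ) : ℝ) by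
        push_cast; ring,
      Real.rpow_add (by positivity), Real.rpow_natCast, pow_mul,
      show (η * s / 2) ^ 2 = η ^ 2 * s ^ 2 / 4 by ring]
    ring
  have key : η ^ ((1 : ℝ) - n) * ((η * s) ^ ((n : ℝ) / 2) * (η * s / 2) ^ ((n : ℝ) / 2 - 1)) =
      (2 : ℝ) ^ (1 - (n : ℝ) / 2) * s ^ (n - 1) := by
    rw [Real.div_rpow hy.le (by norm_num), pow_pred_eq hn]
    rw [show (1 : ℝ) - (n : ℝ) / 2 = -((n : ℝ) / 2 - 1) by ring, Real.rpow_neg (by norm_num) (_ - 1)]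
    have : (η * s) ^ ((n : ℝ) / 2) * (η * s) ^ ((n : ℝ) / 2 - 1) =
        η ^ ((n : ℝ) - 1) * s ^ ((n : ℝ) - 1) := by
      rw [← Real.rpow_add hy, ← Real.mul_rpow hη.le hs.le]
      congr 1; ring
    have h2 : η ^ ((1 : ℝ) - n) * η ^ ((n : ℝ) - 1) = 1 := by
      rw [← Real.rpow_add hη, show (1 : ℝ) - n + (n - 1) = 0 by ring, Real.rpow_zero]
    rw [div_eq_mul_inv ((η * s) ^ _)]
    linear_combination (η ^ ((1 : ℝ) - n) * ((2 : ℝ) ^ ((n : ℝ) / 2 - 1))⁻¹) * this +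
      (s ^ ((n : ℝ) - 1) * ((2 : ℝ) ^ ((n : ℝ) / 2 - 1))⁻¹) * h2
  simp only [hJ, Polynomial.eval_one]
  linear_combination (Real.exp (-(s ^ (2 * m))) * Psi ((n : ℝ) / 2) (η ^ 2 * s ^ 2)) * key

/-- for `0 ≤ β < n` the weighted integral `∫_0^∞ η^{n-1-β} f_{m,n}(η) dη`
is finite and strictly positive. -/
theorem fmn_weighted_integral_positive (m n : ℕ) (hm : 1 ≤ m) (hn : 1 ≤ n)
    (β : ℝ) (hβ0 : 0 ≤ β) (hβn : β < n) :
    IntegrableOn (fun η : ℝ => η ^ ((n : ℝ) - 1 - β) * fmn m n η) (Set.Ioi 0) ∧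
    0 < ∫ η in Set.Ioi (0 : ℝ), η ^ ((n : ℝ) - 1 - β) * fmn m n η := by
  have hc : (0 : ℝ) < (2 : ℝ) ^ (1 - (n : ℝ) / 2) := Real.rpow_pos_of_pos (by norm_num) _
  have heq : Set.EqOn (fun η : ℝ => (2 : ℝ) ^ (1 - (n : ℝ) / 2) *
      (η ^ ((n : ℝ) - 1 - β) * FQ m n 1 η))
      (fun η : ℝ => η ^ ((n : ℝ) - 1 - β) * fmn m n η) (Set.Ioi 0) := by
    intro η hη
    simp only
    rw [fmn_eq hn hη]
    ring
  refine ⟨IntegrableOn.congr_fun ((FQ_weighted_integrable hm hn 1 hβ0 hβn).const_mul _) heq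
    measurableSet_Ioi, ?_⟩
  rw [← setIntegral_congr_fun measurableSet_Ioi heq, integral_const_mul]
  refine mul_pos hc ?_
  rcases hβ0.eq_or_lt with h | h
  · subst h
    simpa only [sub_zero] using FQ_pos_zero hm hn
  · exact FQ_pos_pos hm hn h hβn
end

section
/- Let n ≥ 1. For every multi-index ℓ = (ℓ_1,…,ℓ_n) ∈ ℕ^n the following hold: (1) M_{Δ²P_ℓ} = −|ℓ| · M_{P_ℓ}, where Δ²P_ℓ is the bilaplacian of the monomial P_ℓ (a polynomial); (2) if |ℓ| is not a multiple of 4, or if at least one ℓ_i is odd, then M_{P_ℓ} = 0; (3) if |ℓ| is a multiple of 8 and all ℓ_i are even, then M_{P_ℓ} > 0; (4) if |ℓ| ≡ 4 (mod 8) and all ℓ_i are even, then M_{P_ℓ} < 0. -/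
open MeasureTheory Real Filter Topology

noncomputable def pd {n : ℕ} (i : Fin n) (f : EuclideanSpace ℝ (Fin n) → ℝ)
    (x : EuclideanSpace ℝ (Fin n)) : ℝ :=
  fderiv ℝ f x (EuclideanSpace.single i 1)

/-- The Laplacian on `ℝⁿ` as a sum of second partial derivatives. -/
noncomputable def lap (n : ℕ) (f : EuclideanSpace ℝ (Fin n) → ℝ) :
    EuclideanSpace ℝ (Fin n) → ℝ :=
  fun x => ∑ i : Fin n, pd i (pd i f) x

/-- The rescaled biharmonic heat kernel `v_∞(y) = 2^{n/2} α_n f_n(√2 |y|)`. -/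
noncomputable def vinf (n : ℕ) (α : ℝ) (y : EuclideanSpace ℝ (Fin n)) : ℝ :=
  2 ^ ((n : ℝ) / 2) * α * fmn 2 n (Real.sqrt 2 * ‖y‖)

/-- The monomial `P_ℓ(y) = ∏ᵢ yᵢ^{ℓᵢ}`. -/
noncomputable def monom {n : ℕ} (ℓ : Fin n → ℕ) (y : EuclideanSpace ℝ (Fin n)) : ℝ :=
  ∏ i : Fin n, y i ^ ℓ i


noncomputable def bterm (μ t : ℝ) (k : ℕ) : ℝ :=
  (-t) ^ k / (Nat.factorial k * Real.Gamma ((k : ℝ) + μ))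

noncomputable def bpsi (μ t : ℝ) : ℝ := ∑' k : ℕ, bterm μ t k

lemma gamma_lb {μ : ℝ} (hμ : 0 < μ) : ∃ c : ℝ, 0 < c ∧ ∀ k : ℕ, c ≤ Real.Gamma ((k : ℝ) + μ) := by
  have h1 : ∀ k : ℕ, Real.Gamma (1 + μ) ≤ Real.Gamma ((k : ℝ) + 1 + μ) := by
    intro k
    induction k with
    | zero => simp
    | succ k ih =>
      refine ih.trans ?_
      have : Real.Gamma (((k + 1 : ℕ) : ℝ) + 1 + μ)
          = ((k : ℝ) + 1 + μ) * Real.Gamma ((k : ℝ) + 1 + μ) := by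
        rw [← Real.Gamma_add_one (by positivity)]
        congr 1; push_cast; ring
      rw [this]
      have hp : 0 < Real.Gamma ((k : ℝ) + 1 + μ) := Real.Gamma_pos_of_pos (by positivity)
      nlinarith [(Nat.cast_nonneg k : (0 : ℝ) ≤ k)]
  refine ⟨min (Real.Gamma μ) (Real.Gamma (1 + μ)),
    lt_min (Real.Gamma_pos_of_pos hμ) (Real.Gamma_pos_of_pos (by positivity)), ?_⟩
  intro k
  cases k with
  | zero => simp
  | succ k => exact (min_le_right _ _).trans (by simpa using h1 k)

lemma bterm_bound {μ : ℝ} (hμ : 0 < μ) : ∃ c : ℝ, 0 < c ∧ ∀ (t R : ℝ), |t| ≤ R → ∀ k : ℕ,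
    |bterm μ t k| ≤ c * (R ^ k / Nat.factorial k) := by
  obtain ⟨c, hc, h⟩ := gamma_lb hμ
  refine ⟨c⁻¹, by positivity, ?_⟩
  intro t R hR k
  have hp : 0 < Real.Gamma ((k : ℝ) + μ) := hc.trans_le (h k)
  have hR0 : 0 ≤ R := (abs_nonneg t).trans hR
  rw [bterm, abs_div, abs_pow, abs_neg, abs_of_pos (by positivity : 0 < (Nat.factorial k : ℝ) * Real.Gamma ((k : ℝ) + μ))]
  have : c⁻¹ * (R ^ k / Nat.factorial k) = R ^ k / (Nat.factorial k * c) := by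
    field_simp
  rw [this]
  gcongr
  exact h k

lemma bterm_summable {μ : ℝ} (hμ : 0 < μ) (t : ℝ) : Summable (bterm μ t) := by
  obtain ⟨c, hc, h⟩ := bterm_bound hμ
  refine Summable.of_norm_bounded ((Real.summable_pow_div_factorial |t|).mul_left c) ?_
  intro k
  exact h t |t| le_rfl k

lemma bpsi_hasDerivAt {μ : ℝ} (hμ : 0 < μ) (t : ℝ) :
    HasDerivAt (bpsi μ) (-bpsi (μ + 1) t) t := by
  have hsplit : bpsi μ = fun t => bterm μ t 0 + ∑' k : ℕ, bterm μ t (k + 1) := by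
    funext t
    exact (bterm_summable hμ t).tsum_eq_zero_add
  have h0 : (fun t => bterm μ t 0) = fun _ => bterm μ 0 0 := by
    funext t; simp [bterm]
  obtain ⟨c, hc, h⟩ := bterm_bound (show 0 < μ + 1 by positivity)
  have key : HasDerivAt (fun t => ∑' k : ℕ, bterm μ t (k + 1)) (∑' k : ℕ, -bterm (μ + 1) t k) t := by
    refine hasDerivAt_tsum_of_isPreconnected (t := Metric.ball (0 : ℝ) (|t| + 1))
      (g' := fun k y => -bterm (μ + 1) y k)
      (u := fun k => c * ((|t| + 1) ^ k / Nat.factorial k))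
      ((Real.summable_pow_div_factorial (|t| + 1)).mul_left c) Metric.isOpen_ball
      (convex_ball _ _).isPreconnected ?_ ?_ (y₀ := t) ?_ ?_ ?_
    · intro k y _
      unfold bterm
      have := ((hasDerivAt_neg y).pow (k + 1)).div_const
        ((Nat.factorial (k + 1) : ℝ) * Real.Gamma (((k + 1 : ℕ) : ℝ) + μ))
      refine this.congr_deriv ?_
      have e : ((k + 1 : ℕ) : ℝ) + μ = k + (μ + 1) := by push_cast; ring
      have hp : 0 < Real.Gamma ((k : ℝ) + (μ + 1)) := Real.Gamma_pos_of_pos (by positivity)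
      rw [e, Nat.factorial_succ]
      push_cast
      have : (0 : ℝ) < k + 1 := by positivity
      have : (0 : ℝ) < Nat.factorial k := by positivity
      field_simp
    · intro k y hy
      rw [norm_neg]
      refine h y _ ?_ k
      simpa using (mem_ball_zero_iff.mp hy).le
    · simp
    · exact (summable_nat_add_iff 1).mpr (bterm_summable hμ t)
    · simp
  rw [hsplit]
  have h2 : HasDerivAt (fun t => bterm μ t 0) 0 t := by rw [h0]; exact hasDerivAt_const _ _
  have := h2.add key
  rw [tsum_neg, zero_add] at this
  exact this

lemma bpsi_rec {μ : ℝ} (hμ : 0 < μ) (t : ℝ) :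
    bpsi μ t = μ * bpsi (μ + 1) t - t * bpsi (μ + 2) t := by
  have s0 := bterm_summable hμ t
  have s1 := bterm_summable (show 0 < μ + 1 by positivity) t
  have s2 := bterm_summable (show 0 < μ + 2 by positivity) t
  have e1 : ∀ k : ℕ, bterm μ t (k + 1) = μ * bterm (μ + 1) t (k + 1) - t * bterm (μ + 2) t k := by
    intro k
    unfold bterm
    have a1 : ((k + 1 : ℕ) : ℝ) + (μ + 1) = (k + 1 + μ) + 1 := by push_cast; ring
    have a2 : (k : ℝ) + (μ + 2) = (k + 1 + μ) + 1 := by ring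
    have a0 : ((k + 1 : ℕ) : ℝ) + μ = k + 1 + μ := by push_cast; ring
    have hp : 0 < Real.Gamma ((k : ℝ) + 1 + μ) := Real.Gamma_pos_of_pos (by positivity)
    rw [a1, a2, a0, Real.Gamma_add_one (by positivity), Nat.factorial_succ]
    push_cast
    have : (0 : ℝ) < Nat.factorial k := by positivity
    have : (0 : ℝ) < k + 1 + μ := by positivity
    field_simp
    ring
  have e0 : bterm μ t 0 = μ * bterm (μ + 1) t 0 := by
    unfold bterm
    have hp : 0 < Real.Gamma μ := Real.Gamma_pos_of_pos hμ
    simp [Real.Gamma_add_one hμ.ne']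
    field_simp
  have b0 : bpsi μ t = _ := s0.tsum_eq_zero_add
  have b1 : bpsi (μ + 1) t = _ := s1.tsum_eq_zero_add
  have s1' := ((summable_nat_add_iff 1).mpr s1).mul_left μ
  rw [b0, b1, e0, mul_add]
  simp_rw [e1]
  rw [(s1'.tsum_sub (s2.mul_left t)), tsum_mul_left, tsum_mul_left]
  unfold bpsi
  ring

/-- `Phi d z = z^{-ν} J_ν(z)` with `ν = (d-1)/2`, i.e. space dimension `d+1`. -/
noncomputable def Phi (d : ℕ) (z : ℝ) : ℝ :=
  2 ^ (-(((d : ℝ) - 1) / 2)) * bpsi (((d : ℝ) + 1) / 2) (z ^ 2 / 4)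

lemma Phi_add_two (d : ℕ) (z : ℝ) : Phi (d + 2) z =
    2 ^ (-(((d : ℝ) - 1) / 2)) / 2 * bpsi (((d : ℝ) + 1) / 2 + 1) (z ^ 2 / 4) := by
  unfold Phi
  have e : (((d + 2 : ℕ) : ℝ) + 1) / 2 = ((d : ℝ) + 1) / 2 + 1 := by push_cast; ring
  have e2 : -((((d + 2 : ℕ) : ℝ) - 1) / 2) = -(((d : ℝ) - 1) / 2) - 1 := by push_cast; ring
  rw [e, e2, Real.rpow_sub (by norm_num), Real.rpow_one]

lemma Phi_hasDerivAt (d : ℕ) (z : ℝ) : HasDerivAt (Phi d) (-z * Phi (d + 2) z) z := by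
  have h1 : HasDerivAt (fun z : ℝ => z ^ 2 / 4) (z / 2) z := by
    have := (hasDerivAt_pow 2 z).div_const 4
    refine this.congr_deriv ?_
    norm_num; ring
  have h2 := (bpsi_hasDerivAt (show 0 < ((d : ℝ) + 1) / 2 by positivity) (z ^ 2 / 4)).comp z h1
  have h3 := h2.const_mul (2 ^ (-(((d : ℝ) - 1) / 2)) : ℝ)
  refine h3.congr_deriv ?_
  rw [Phi_add_two]
  ring

lemma Phi_rec (d : ℕ) (z : ℝ) : Phi d z = (d + 1) * Phi (d + 2) z - z ^ 2 * Phi (d + 4) z := by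
  have : Phi (d + 4) z = 2 ^ (-(((d : ℝ) - 1) / 2)) / 4 * bpsi (((d : ℝ) + 1) / 2 + 2) (z ^ 2 / 4) := by
    rw [show d + 4 = (d + 2) + 2 by ring, Phi_add_two]
    have e : (((d + 2 : ℕ) : ℝ) + 1) / 2 + 1 = ((d : ℝ) + 1) / 2 + 2 := by push_cast; ring
    have e2 : -((((d + 2 : ℕ) : ℝ) - 1) / 2) = -(((d : ℝ) - 1) / 2) - 1 := by push_cast; ring
    rw [e, e2, Real.rpow_sub (by norm_num), Real.rpow_one]
    ring
  rw [this, Phi_add_two]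
  unfold Phi
  rw [bpsi_rec (show 0 < ((d : ℝ) + 1) / 2 by positivity)]
  ring

lemma Phi_continuous (d : ℕ) : Continuous (Phi d) :=
  continuous_iff_continuousAt.mpr fun z => (Phi_hasDerivAt d z).continuousAt

lemma Phi_bound (d : ℕ) {z : ℝ} (hz : 0 ≤ z) : |Phi d z| ≤ |Phi d 0| := by
  let E : ℝ → ℝ := fun z => z ^ 2 * Phi (d + 2) z ^ 2 + Phi d z ^ 2
  have hE : ∀ z, HasDerivAt E (-(2 * d * z * Phi (d + 2) z ^ 2)) z := by
    intro z
    have h := (((hasDerivAt_pow 2 z).mul ((Phi_hasDerivAt (d + 2) z).pow 2)).add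
      ((Phi_hasDerivAt d z).pow 2))
    refine h.congr_deriv ?_
    have := Phi_rec d z
    rw [show d + 2 + 2 = d + 4 by ring]
    simp
    rw [this]
    ring
  have hanti : AntitoneOn E (Set.Ici 0) := by
    refine antitoneOn_of_deriv_nonpos (convex_Ici 0)
      (fun z _ => (hE z).continuousAt.continuousWithinAt)
      (fun z _ => (hE z).differentiableAt.differentiableWithinAt) ?_
    intro x hx
    rw [interior_Ici] at hx
    rw [(hE x).deriv]
    have : 0 ≤ 2 * d * x * Phi (d + 2) x ^ 2 := by
      have := (Set.mem_Ioi.mp hx).le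
      positivity
    linarith
  have h := hanti (Set.mem_Ici.mpr le_rfl) (Set.mem_Ici.mpr hz) hz
  rw [← sq_le_sq]
  simp only [E] at h
  nlinarith [mul_nonneg (sq_nonneg z) (sq_nonneg (Phi (d + 2) z))]

lemma Phi_bound' (d : ℕ) (z : ℝ) : |Phi d z| ≤ |Phi d 0| := by
  have : Phi d z = Phi d |z| := by unfold Phi; rw [sq_abs]
  rw [this]
  exact Phi_bound d (abs_nonneg z)

lemma integral_deriv_Ioi {f f' : ℝ → ℝ} (h : ∀ x, HasDerivAt f (f' x) x)
    (hf : IntegrableOn f (Set.Ioi 0)) (hf' : IntegrableOn f' (Set.Ioi 0)) :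
    ∫ x in Set.Ioi (0 : ℝ), f' x = - f 0 := by
  have ht := tendsto_zero_of_hasDerivAt_of_integrableOn_Ioi (a := 0) (fun x _ => h x) hf' hf
  rw [integral_Ioi_of_hasDerivAt_of_tendsto' (fun x _ => h x) hf' ht, zero_sub]

lemma integrable_pe (p : ℕ) :
    IntegrableOn (fun s : ℝ => s ^ p * Real.exp (-(s ^ 4))) (Set.Ioi 0) := by
  have := integrableOn_rpow_mul_exp_neg_mul_rpow (p := 4) (s := p) (b := 1)
    (by have : (0 : ℝ) ≤ p := by positivity
        linarith) (by norm_num) (by norm_num)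
  refine this.congr_fun (fun x _ => ?_) measurableSet_Ioi
  have h4 : x ^ (4 : ℝ) = x ^ (4 : ℕ) := by rw [← Real.rpow_natCast]; norm_num
  simp [h4, Real.rpow_natCast]

noncomputable def II (p d : ℕ) (η : ℝ) : ℝ :=
  ∫ s in Set.Ioi (0 : ℝ), s ^ p * Real.exp (-(s ^ 4)) * Phi d (η * s)

lemma II_meas (p d : ℕ) (η : ℝ) :
    Continuous (fun s : ℝ => s ^ p * Real.exp (-(s ^ 4)) * Phi d (η * s)) := by
  have := (Phi_continuous d).comp (continuous_const.mul continuous_id : Continuous fun s : ℝ => η * s)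
  simp only [Function.comp_def] at this
  fun_prop

lemma II_integrand_bound (p d : ℕ) (η : ℝ) {s : ℝ} (hs : 0 < s) :
    ‖s ^ p * Real.exp (-(s ^ 4)) * Phi d (η * s)‖ ≤ |Phi d 0| * (s ^ p * Real.exp (-(s ^ 4))) := by
  rw [norm_mul, Real.norm_of_nonneg (by positivity), mul_comm]
  exact mul_le_mul_of_nonneg_right (Phi_bound' _ _) (by positivity)

lemma II_integrable (p d : ℕ) (η : ℝ) :
    IntegrableOn (fun s : ℝ => s ^ p * Real.exp (-(s ^ 4)) * Phi d (η * s)) (Set.Ioi 0) := by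
  refine Integrable.mono' ((integrable_pe p).const_mul |Phi d 0|)
    (II_meas p d η).aestronglyMeasurable ?_
  filter_upwards [ae_restrict_mem measurableSet_Ioi] with s hs
  exact II_integrand_bound p d η hs

lemma II_bound (p d : ℕ) : ∃ C : ℝ, ∀ η, |II p d η| ≤ C := by
  refine ⟨∫ s in Set.Ioi (0 : ℝ), |Phi d 0| * (s ^ p * Real.exp (-(s ^ 4))), fun η => ?_⟩
  rw [← Real.norm_eq_abs]
  unfold II
  refine norm_integral_le_of_norm_le ((integrable_pe p).const_mul _) ?_
  filter_upwards [ae_restrict_mem measurableSet_Ioi] with s hs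
  exact II_integrand_bound p d η hs

lemma Phi_scaled_deriv (d : ℕ) (η s : ℝ) :
    HasDerivAt (fun s => Phi d (η * s)) (-(η ^ 2 * s * Phi (d + 2) (η * s))) s := by
  have h := (Phi_hasDerivAt d (η * s)).comp s ((hasDerivAt_id s).const_mul η)
  refine h.congr_deriv ?_
  ring

lemma II_ibp (p d : ℕ) (η : ℝ) :
    η ^ 2 * II (p + 2) (d + 2) η = (p + 1) * II p d η - 4 * II (p + 4) d η := by
  have h : ∀ s : ℝ, HasDerivAt (fun s : ℝ => s ^ (p + 1) * Real.exp (-(s ^ 4)) * Phi d (η * s))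
      ((p + 1) * (s ^ p * Real.exp (-(s ^ 4)) * Phi d (η * s))
        - 4 * (s ^ (p + 4) * Real.exp (-(s ^ 4)) * Phi d (η * s))
        - η ^ 2 * (s ^ (p + 2) * Real.exp (-(s ^ 4)) * Phi (d + 2) (η * s))) s := by
    intro s
    have h1 := ((hasDerivAt_pow (p + 1) s).mul ((hasDerivAt_pow 4 s).neg.exp)).mul
      (Phi_scaled_deriv d η s)
    refine h1.congr_deriv ?_
    simp
    ring
  have i1 := (II_integrable p d η).const_mul ((p : ℝ) + 1)
  have i2 := (II_integrable (p + 4) d η).const_mul 4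
  have i3 := (II_integrable (p + 2) (d + 2) η).const_mul (η ^ 2)
  have i12 : IntegrableOn (fun s : ℝ => ((p : ℝ) + 1) * (s ^ p * Real.exp (-(s ^ 4)) * Phi d (η * s))
      - 4 * (s ^ (p + 4) * Real.exp (-(s ^ 4)) * Phi d (η * s))) (Set.Ioi 0) := i1.sub i2
  have := integral_deriv_Ioi h (II_integrable _ _ _) (i12.sub i3)
  rw [integral_sub i12 i3, integral_sub i1 i2, integral_const_mul, integral_const_mul,
    integral_const_mul] at this
  simp at this
  unfold II
  linarith

lemma II_rec (p d : ℕ) (η : ℝ) :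
    II p d η = (d + 1) * II p (d + 2) η - η ^ 2 * II (p + 2) (d + 4) η := by
  have i1 := (II_integrable p (d + 2) η).const_mul ((d : ℝ) + 1)
  have i2 := (II_integrable (p + 2) (d + 4) η).const_mul (η ^ 2)
  unfold II
  rw [← integral_const_mul, ← integral_const_mul, ← integral_sub i1 i2]
  congr 1
  funext s
  rw [Phi_rec d]
  ring

lemma II_shift (p d : ℕ) (η : ℝ) :
    II p d η = (d - p) * II p (d + 2) η + 4 * II (p + 4) (d + 2) η := by
  have h1 := II_rec p d η
  have h2 := II_ibp p (d + 2) η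
  rw [show d + 2 + 2 = d + 4 by ring] at h2
  rw [h1, h2]
  ring

lemma II_hasDerivAt (p d : ℕ) (η : ℝ) :
    HasDerivAt (II p d) (-(η * II (p + 2) (d + 2) η)) η := by
  have h := hasDerivAt_integral_of_dominated_loc_of_deriv_le (μ := volume.restrict (Set.Ioi (0 : ℝ)))
    (F := fun η s => s ^ p * Real.exp (-(s ^ 4)) * Phi d (η * s))
    (F' := fun η s => -(η * (s ^ (p + 2) * Real.exp (-(s ^ 4)) * Phi (d + 2) (η * s))))
    (x₀ := η) (s := Metric.ball η 1)
    (bound := fun s => (|η| + 1) * (|Phi (d + 2) 0| * (s ^ (p + 2) * Real.exp (-(s ^ 4)))))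
    (Metric.ball_mem_nhds _ one_pos)
    (Eventually.of_forall fun x => (II_meas p d x).aestronglyMeasurable)
    (II_integrable p d η)
    ((II_meas (p + 2) (d + 2) η).const_mul η).neg.aestronglyMeasurable
    ?_ (((integrable_pe (p + 2)).const_mul _).const_mul _) ?_
  · refine h.2.congr_deriv ?_
    rw [integral_neg, integral_const_mul]
    rfl
  · filter_upwards [ae_restrict_mem measurableSet_Ioi] with s hs x hx
    rw [norm_neg, norm_mul]
    refine mul_le_mul ?_ (II_integrand_bound _ _ _ hs) (norm_nonneg _) (by positivity)
    have := Metric.mem_ball.mp hx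
    rw [Real.dist_eq] at this
    rw [Real.norm_eq_abs]
    have := abs_sub_abs_le_abs_sub x η
    linarith
  · refine Eventually.of_forall fun s x _ => ?_
    have h := ((Phi_hasDerivAt d (x * s)).comp x ((hasDerivAt_id x).mul_const s)).const_mul
      (s ^ p * Real.exp (-(s ^ 4)))
    refine h.congr_deriv ?_
    simp
    ring

lemma II_continuous (p d : ℕ) : Continuous (II p d) :=
  continuous_iff_continuousAt.mpr fun z => (II_hasDerivAt p d z).continuousAt

lemma II_decay (d k : ℕ) : ∀ j : ℕ, ∃ C : ℝ, ∀ η, |η ^ (2 * k) * II (2 * j + d) d η| ≤ C := by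
  induction k with
  | zero => intro j; simpa using II_bound (2 * j + d) d
  | succ k ih =>
    have step : ∀ j : ℕ, ∃ C : ℝ, ∀ η, |η ^ (2 * (k + 1)) * II (2 * j + d + 2) (d + 2) η| ≤ C := by
      intro j
      obtain ⟨C1, h1⟩ := ih j
      obtain ⟨C2, h2⟩ := ih (j + 2)
      refine ⟨((2 * j + d : ℕ) + 1) * C1 + 4 * C2, fun η => ?_⟩
      have : η ^ (2 * (k + 1)) * II (2 * j + d + 2) (d + 2) η =
          ((2 * j + d : ℕ) + 1) * (η ^ (2 * k) * II (2 * j + d) d η)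
            - 4 * (η ^ (2 * k) * II (2 * (j + 2) + d) d η) := by
        have := II_ibp (2 * j + d) d η
        rw [show 2 * (j + 2) + d = 2 * j + d + 4 by ring, show 2 * (k + 1) = 2 * k + 2 by ring, pow_add,
          mul_assoc, this]
        ring
      rw [this]
      refine (abs_sub _ _).trans ?_
      rw [abs_mul, abs_mul 4, abs_of_nonneg (by positivity : (0 : ℝ) ≤ ((2 * j + d : ℕ) + 1)),
        abs_of_pos (by norm_num : (0 : ℝ) < 4)]
      gcongr
      · exact h1 η
      · exact h2 η
    intro j
    obtain ⟨C2, h2⟩ := step (j + 1)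
    obtain ⟨C1, h1⟩ : ∃ C : ℝ, ∀ η, |2 * j * (η ^ (2 * (k + 1)) * II (2 * j + d) (d + 2) η)| ≤ C := by
      cases j with
      | zero => exact ⟨0, by simp⟩
      | succ j =>
        obtain ⟨C, h⟩ := step j
        refine ⟨2 * (j + 1 : ℕ) * C, fun η => ?_⟩
        rw [abs_mul, abs_of_nonneg (by positivity)]
        refine mul_le_mul_of_nonneg_left ?_ (by positivity)
        rw [show 2 * (j + 1) + d = 2 * j + d + 2 by ring]
        exact h η
    refine ⟨C1 + 4 * C2, fun η => ?_⟩
    have : η ^ (2 * (k + 1)) * II (2 * j + d) d η =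
        -(2 * j * (η ^ (2 * (k + 1)) * II (2 * j + d) (d + 2) η))
         + 4 * (η ^ (2 * (k + 1)) * II (2 * (j + 1) + d + 2) (d + 2) η) := by
      rw [II_shift (2 * j + d) d η, show 2 * (j + 1) + d + 2 = 2 * j + d + 4 by ring]
      push_cast
      ring
    rw [this]
    refine (abs_add_le _ _).trans ?_
    rw [abs_neg, abs_mul 4, abs_of_pos (by norm_num : (0 : ℝ) < 4)]
    have := h1 η
    have := h2 η
    linarith

lemma II_mom_integrable (q d j : ℕ) :
    IntegrableOn (fun η : ℝ => η ^ q * II (2 * j + d) d η) (Set.Ioi 0) := by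
  obtain ⟨C0, h0⟩ := II_decay d 0 j
  obtain ⟨C1, h1⟩ := II_decay d 1 j
  obtain ⟨C2, h2⟩ := II_decay d q j
  obtain ⟨C3, h3⟩ := II_decay d (q + 1) j
  refine Integrable.mono' ((integrable_inv_one_add_sq.const_mul (C0 + C1 + C2 + C3)).integrableOn)
    ((continuous_pow q).mul (II_continuous _ _)).aestronglyMeasurable ?_
  filter_upwards [ae_restrict_mem measurableSet_Ioi] with η hη
  have hη : 0 < η := hη
  have a0 := h0 η
  have a1 := h1 η
  have a2 := h2 η
  have a3 := h3 η
  rw [abs_mul, abs_of_nonneg (by positivity)] at a0 a1 a2 a3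
  rw [norm_mul, Real.norm_of_nonneg (by positivity), Real.norm_eq_abs, ← div_eq_mul_inv,
    le_div_iff₀ (by positivity)]
  have hq : η ^ q ≤ 1 + η ^ (2 * q) := by
    rw [mul_comm, pow_mul]
    nlinarith [sq_nonneg (η ^ q - 1)]
  have hI := abs_nonneg (II (2 * j + d) d η)
  calc η ^ q * |II (2 * j + d) d η| * (1 + η ^ 2)
      ≤ (1 + η ^ (2 * q)) * |II (2 * j + d) d η| * (1 + η ^ 2) := by gcongr
    _ = η ^ (2 * 0) * |II (2 * j + d) d η| + η ^ (2 * 1) * |II (2 * j + d) d η|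
        + η ^ (2 * q) * |II (2 * j + d) d η| + η ^ (2 * (q + 1)) * |II (2 * j + d) d η| := by
      ring
    _ ≤ _ := by linarith

noncomputable def KK (q p d : ℕ) : ℝ := ∫ η in Set.Ioi (0 : ℝ), η ^ q * II p d η

lemma KK_e (q j d : ℕ) :
    (q + 1) * KK q (2 * j + d) d = KK (q + 2) (2 * j + d + 2) (d + 2) := by
  have h : ∀ η : ℝ, HasDerivAt (fun η : ℝ => η ^ (q + 1) * II (2 * j + d) d η)
      ((q + 1) * (η ^ q * II (2 * j + d) d η) - η ^ (q + 2) * II (2 * j + d + 2) (d + 2) η) η := by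
    intro η
    have := (hasDerivAt_pow (q + 1) η).mul (II_hasDerivAt (2 * j + d) d η)
    refine this.congr_deriv ?_
    simp
    ring
  have i1 := (II_mom_integrable q d j).const_mul ((q : ℝ) + 1)
  have i2 := II_mom_integrable (q + 2) (d + 2) j
  rw [← add_assoc] at i2
  have := integral_deriv_Ioi h (II_mom_integrable (q + 1) d j) (i1.sub i2)
  rw [integral_sub i1 i2, integral_const_mul] at this
  simp at this
  unfold KK
  linarith

lemma KK_b (q j d : ℕ) :
    KK (q + 2) (2 * j + d + 2) (d + 2)
      = ((2 * j + d : ℕ) + 1) * KK q (2 * j + d) d - 4 * KK q (2 * j + d + 4) d := by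
  have i1 := (II_mom_integrable q d j).const_mul (((2 * j + d : ℕ) : ℝ) + 1)
  have i2 := (II_mom_integrable q d (j + 2)).const_mul 4
  rw [show 2 * (j + 2) + d = 2 * j + d + 4 by ring] at i2
  unfold KK
  rw [← integral_const_mul, ← integral_const_mul, ← integral_sub i1 i2]
  congr 1
  funext η
  have := II_ibp (2 * j + d) d η
  rw [pow_add, mul_assoc, this]
  ring

lemma KK_four (q j d : ℕ) :
    4 * KK q (2 * j + d + 4) d = ((2 * j + d : ℕ) - q : ℝ) * KK q (2 * j + d) d := by
  have h1 := KK_e q j d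
  have h2 := KK_b q j d
  linarith

lemma KK_shift (q j d : ℕ) :
    KK q (2 * j + d + 2) d = (d - q) * KK q (2 * j + d + 2) (d + 2) := by
  have i1 := (II_mom_integrable q (d + 2) j).const_mul ((d : ℝ) - (2 * j + d + 2 : ℕ))
  have i2 := (II_mom_integrable q (d + 2) (j + 2)).const_mul 4
  rw [← add_assoc] at i1
  rw [show 2 * (j + 2) + (d + 2) = 2 * j + d + 2 + 4 by ring] at i2
  have h1 : KK q (2 * j + d + 2) d = ((d : ℝ) - (2 * j + d + 2 : ℕ)) * KK q (2 * j + d + 2) (d + 2)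
      + 4 * KK q (2 * j + d + 2 + 4) (d + 2) := by
    unfold KK
    rw [← integral_const_mul, ← integral_const_mul, ← integral_add i1 i2]
    congr 1
    funext η
    rw [II_shift (2 * j + d + 2) d η]
    ring
  have h2 := KK_four q j (d + 2)
  rw [← add_assoc] at h2
  rw [h1, h2]
  ring

lemma KK_step (N j d : ℕ) : KK (d + (N + 2)) (2 * j + d + 2) d
    = -((N + 2) * (d + N + 1)) * KK (d + N) (2 * j + d) d := by
  have h1 := KK_shift (d + (N + 2)) j d
  have h2 := KK_e (d + N) j d
  rw [show d + (N + 2) = d + N + 2 by ring] at *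
  rw [h1, ← h2]
  push_cast
  ring

lemma KK_zero (j d : ℕ) : KK d (2 * j + d + 2) d = 0 := by
  rw [KK_shift]; simp

/-- Radial moments of the profile. -/
noncomputable def RR (d N : ℕ) : ℝ := KK (d + N) d d

lemma RR_two (d : ℕ) : RR d 2 = 0 := by
  have h1 := KK_four (d + 2) 0 d
  have h2 := KK_step 0 1 d
  have h3 := KK_zero 0 d
  simp only [mul_zero, zero_add, add_zero, mul_one] at h1 h2 h3
  rw [show 2 + d + 2 = d + 4 by ring, show 2 + d = d + 2 by ring, h3] at h2
  rw [h2] at h1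
  push_cast at h1
  unfold RR
  linarith

lemma RR_rec (d N : ℕ) :
    RR d (N + 4) = -(4 * (N + 2) * (d + N + 3) * (d + N + 1)) * RR d N := by
  have h1 := KK_four (d + (N + 4)) 0 d
  have h2 := KK_step (N + 2) 1 d
  have h3 := KK_step N 0 d
  simp only [mul_zero, zero_add, mul_one] at h1 h2 h3
  rw [show 2 + d + 2 = d + 4 by ring, show 2 + d = d + 2 by ring, h3] at h2
  rw [show N + 2 + 2 = N + 4 by ring] at h2
  rw [h2] at h1
  push_cast at h1
  unfold RR
  have hN : (0 : ℝ) < N + 4 := by positivity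
  have : ((N : ℝ) + 4) * KK (d + (N + 4)) d d = ((N : ℝ) + 4) *
      (-(4 * (N + 2) * (d + N + 3) * (d + N + 1)) * KK (d + N) d d) := by
    linear_combination h1
  exact mul_left_cancel₀ hN.ne' this

lemma besselJ_eq (d : ℕ) {z : ℝ} (hz : 0 < z) :
    besselJ ((((d + 1 : ℕ) : ℝ) - 2) / 2) z = z ^ (((d : ℝ) - 1) / 2) * Phi d z := by
  unfold besselJ Phi bpsi
  rw [← mul_assoc, ← tsum_mul_left]
  congr 1
  funext k
  unfold bterm
  have e1 : (((d + 1 : ℕ) : ℝ) - 2) / 2 = ((d : ℝ) - 1) / 2 := by push_cast; ring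
  have e2 : (k : ℝ) + ((d : ℝ) - 1) / 2 + 1 = k + ((d : ℝ) + 1) / 2 := by ring
  rw [e1, e2, Real.rpow_add (by positivity), Real.rpow_neg (by norm_num),
    Real.div_rpow hz.le (by norm_num) (((d : ℝ) - 1) / 2)]
  have e3 : (z / 2) ^ (2 * (k : ℝ)) = (z ^ 2 / 4) ^ k := by
    rw [Real.rpow_mul (by positivity), Real.rpow_natCast]
    congr 1
    rw [Real.rpow_two]; ring
  rw [e3, neg_pow (z ^ 2 / 4)]
  ring

lemma fmn_eq_s8 (d : ℕ) {η : ℝ} (hη : 0 < η) : fmn 2 (d + 1) η = II d d η := by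
  unfold fmn II
  rw [← integral_const_mul]
  refine setIntegral_congr_fun measurableSet_Ioi (fun s hs => ?_)
  have hs : 0 < s := hs
  have hz : 0 < η * s := by positivity
  rw [besselJ_eq d hz]
  have e : (η * s) ^ (((d + 1 : ℕ) : ℝ) / 2) * (η * s) ^ (((d : ℝ) - 1) / 2) = η ^ (d : ℝ) * s ^ d := by
    rw [← Real.rpow_add hz, ← Real.rpow_natCast s, ← Real.mul_rpow hη.le hs.le]
    congr 1; push_cast; ring
  have e2 : η ^ ((1 : ℝ) - (d + 1 : ℕ)) * η ^ (d : ℝ) = 1 := by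
    rw [← Real.rpow_add hη]
    push_cast
    simp
  rw [show 2 * 2 = 4 by norm_num]
  calc _ = (η ^ ((1 : ℝ) - (d + 1 : ℕ)) * (Real.exp (-s ^ 4) *
        ((η * s) ^ (((d + 1 : ℕ) : ℝ) / 2) * (η * s) ^ (((d : ℝ) - 1) / 2)) * Phi d (η * s))) := by ring
    _ = (η ^ ((1 : ℝ) - (d + 1 : ℕ)) * η ^ (d : ℝ)) * (Real.exp (-s ^ 4) * s ^ d * Phi d (η * s)) := by
      rw [e]; ring
    _ = _ := by rw [e2]; ring

lemma fmn_moment (d N : ℕ) : ∫ r in Set.Ioi (0 : ℝ), r ^ (d + N) * fmn 2 (d + 1) r = RR d N := by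
  unfold RR KK
  refine setIntegral_congr_fun measurableSet_Ioi (fun s hs => ?_)
  rw [fmn_eq_s8 d hs]

lemma fmn_moment_scaled (d N : ℕ) (α : ℝ) :
    ∫ r in Set.Ioi (0 : ℝ), r ^ (d + N) * (2 ^ (((d + 1 : ℕ) : ℝ) / 2) * α * fmn 2 (d + 1) (Real.sqrt 2 * r))
      = 2 ^ (((d + 1 : ℕ) : ℝ) / 2) * α * ((Real.sqrt 2)⁻¹ ^ (d + N + 1)) * RR d N := by
  have h2 : 0 < Real.sqrt 2 := by positivity
  have := integral_comp_mul_left_Ioi (fun r => r ^ (d + N) * fmn 2 (d + 1) r) 0 h2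
  rw [mul_zero, fmn_moment, smul_eq_mul] at this
  have e : ∀ r : ℝ, r ^ (d + N) * (2 ^ (((d + 1 : ℕ) : ℝ) / 2) * α * fmn 2 (d + 1) (Real.sqrt 2 * r))
      = (2 ^ (((d + 1 : ℕ) : ℝ) / 2) * α * ((Real.sqrt 2)⁻¹ ^ (d + N))) *
        ((Real.sqrt 2 * r) ^ (d + N) * fmn 2 (d + 1) (Real.sqrt 2 * r)) := by
    intro r
    rw [mul_pow, inv_pow]
    field_simp
  simp_rw [e]
  rw [integral_const_mul, this]
  ring

lemma polar (d N : ℕ) (P : EuclideanSpace ℝ (Fin (d + 1)) → ℝ)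
    (hP : ∀ (r : ℝ) x, P (r • x) = r ^ N * P x) (h : ℝ → ℝ) :
    ∫ y, P y * h ‖y‖ = (∫ ω : Metric.sphere (0 : EuclideanSpace ℝ (Fin (d + 1))) 1, P ω
        ∂(volume : Measure (EuclideanSpace ℝ (Fin (d + 1)))).toSphere)
      * ∫ r in Set.Ioi (0 : ℝ), r ^ (d + N) * h r := by
  let μ : Measure (EuclideanSpace ℝ (Fin (d + 1))) := volume
  have hdim : Module.finrank ℝ (EuclideanSpace ℝ (Fin (d + 1))) - 1 = d := by simp
  calc ∫ y, P y * h ‖y‖ = ∫ x : ({(0)}ᶜ : Set (EuclideanSpace ℝ (Fin (d + 1)))), P x.1 * h (‖x.1‖) ∂(μ.comap (↑)) := by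
        rw [integral_subtype_comap (measurableSet_singleton _).compl fun x : (EuclideanSpace ℝ (Fin (d + 1))) ↦ P x * h (‖x‖),
          restrict_compl_singleton]
    _ = ∫ x : Metric.sphere (0 : (EuclideanSpace ℝ (Fin (d + 1)))) 1 × Set.Ioi (0 : ℝ), P x.1 * ((x.2 : ℝ) ^ N * h x.2)
          ∂μ.toSphere.prod (.volumeIoiPow (Module.finrank ℝ (EuclideanSpace ℝ (Fin (d + 1))) - 1)) := by
      rw [← μ.measurePreserving_homeomorphUnitSphereProd.integral_comp
        (Homeomorph.measurableEmbedding _)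
        (fun x : Metric.sphere (0 : (EuclideanSpace ℝ (Fin (d + 1)))) 1 × Set.Ioi (0 : ℝ) => P x.1 * ((x.2 : ℝ) ^ N * h x.2))]
      congr 1
      funext x
      simp only [homeomorphUnitSphereProd_apply_snd_coe, homeomorphUnitSphereProd_apply_fst_coe]
      have hx : ‖x.1‖ ≠ 0 := norm_ne_zero_iff.mpr x.2
      rw [hP, inv_pow]
      field_simp
    _ = (∫ ω : Metric.sphere (0 : (EuclideanSpace ℝ (Fin (d + 1)))) 1, P ω ∂μ.toSphere) *
        ∫ x : Set.Ioi (0 : ℝ), ((x : ℝ) ^ N * h x) ∂.volumeIoiPow (Module.finrank ℝ (EuclideanSpace ℝ (Fin (d + 1))) - 1) :=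
      integral_prod_mul (fun ω : Metric.sphere (0 : (EuclideanSpace ℝ (Fin (d + 1)))) 1 => P ω) (fun x : Set.Ioi (0 : ℝ) => (x : ℝ) ^ N * h x)
    _ = _ := by
      congr 1
      simp only [Measure.volumeIoiPow, ENNReal.ofReal, hdim]
      rw [integral_withDensity_eq_integral_smul,
        integral_subtype_comap measurableSet_Ioi fun a ↦ Real.toNNReal (a ^ d) • (a ^ N * h a)]
      · refine setIntegral_congr_fun measurableSet_Ioi fun x hx ↦ ?_
        have hx : 0 < x := hx
        simp only [NNReal.smul_def, Real.coe_toNNReal _ (pow_nonneg hx.le _), smul_eq_mul]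
        ring
      · exact (measurable_subtype_coe.pow_const _).real_toNNReal

/-! Gaussian moments -/

noncomputable def gm (k : ℕ) : ℝ := ∫ x : ℝ, x ^ k * Real.exp (-x ^ 2)

lemma gm_integrable (k : ℕ) : Integrable (fun x : ℝ => x ^ k * Real.exp (-x ^ 2)) := by
  have := integrable_rpow_mul_exp_neg_mul_sq (b := 1) one_pos (s := k)
    (by have : (0 : ℝ) ≤ k := by positivity
        linarith)
  simpa [Real.rpow_natCast] using this

lemma gm_deriv (k : ℕ) (x : ℝ) : HasDerivAt (fun x : ℝ => x ^ (k + 1) * Real.exp (-x ^ 2))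
    ((k + 1) * (x ^ k * Real.exp (-x ^ 2)) - 2 * (x ^ (k + 2) * Real.exp (-x ^ 2))) x := by
  have := (hasDerivAt_pow (k + 1) x).mul ((hasDerivAt_pow 2 x).neg.exp)
  refine this.congr_deriv ?_
  simp
  ring

lemma gm_rec (k : ℕ) : 2 * gm (k + 2) = (k + 1) * gm k := by
  have i1 := (gm_integrable k).const_mul ((k : ℝ) + 1)
  have i2 := (gm_integrable (k + 2)).const_mul 2
  have := integral_eq_zero_of_hasDerivAt_of_integrable (gm_deriv k) (i1.sub i2) (gm_integrable (k + 1))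
  rw [integral_sub i1 i2, integral_const_mul, integral_const_mul] at this
  unfold gm
  linarith

lemma gm_odd {k : ℕ} (hk : Odd k) : gm k = 0 := by
  have h : gm k = -gm k := by
    conv_lhs => rw [gm, ← integral_neg_eq_self]
    rw [gm, ← integral_neg]
    congr 1
    funext x
    rw [hk.neg_pow]
    simp
  linarith

lemma gm_even {k : ℕ} (hk : Even k) : 0 < gm k := by
  obtain ⟨m, rfl⟩ := hk
  induction m with
  | zero =>
    have := integral_gaussian 1
    simp [gm] at *
    rw [this]
    positivity
  | succ m ih =>
    have := gm_rec (m + m)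
    rw [show m + 1 + (m + 1) = m + m + 2 by ring]
    have : 0 < ((m + m : ℕ) + 1 : ℝ) * gm (m + m) := by positivity
    linarith

noncomputable def rg (k : ℕ) : ℝ := ∫ x in Set.Ioi (0 : ℝ), x ^ k * Real.exp (-x ^ 2)

lemma rg_rec (k : ℕ) : 2 * rg (k + 2) = (k + 1) * rg k := by
  have i1 := ((gm_integrable k).const_mul ((k : ℝ) + 1)).integrableOn (s := Set.Ioi 0)
  have i2 := ((gm_integrable (k + 2)).const_mul 2).integrableOn (s := Set.Ioi 0)
  have := integral_deriv_Ioi (gm_deriv k) ((gm_integrable (k + 1)).integrableOn) (i1.sub i2)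
  rw [integral_sub i1 i2, integral_const_mul, integral_const_mul] at this
  simp at this
  unfold rg
  linarith

lemma rg_pos (k : ℕ) : 0 < rg k := by
  unfold rg
  rw [setIntegral_pos_iff_support_of_nonneg_ae]
  · have : Function.support (fun x : ℝ => x ^ k * Real.exp (-x ^ 2)) ∩ Set.Ioi 0 = Set.Ioi 0 := by
      refine Set.inter_eq_right.mpr fun x hx => ?_
      have hx : 0 < x := hx
      have : 0 < x ^ k * Real.exp (-x ^ 2) := by positivity
      exact this.ne'
    rw [this]
    simp
  · filter_upwards [ae_restrict_mem measurableSet_Ioi] with x hx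
    have hx : 0 < x := hx
    simp only [Pi.zero_apply]
    positivity
  · exact (gm_integrable k).integrableOn

noncomputable def GG {n : ℕ} (ℓ : Fin n → ℕ) : ℝ := ∏ i, gm (ℓ i)

lemma monom_gauss_eq {n : ℕ} (ℓ : Fin n → ℕ) (x : Fin n → ℝ) :
    monom ℓ (WithLp.toLp 2 x) * Real.exp (-‖(WithLp.toLp 2 x : EuclideanSpace ℝ (Fin n))‖ ^ 2)
      = ∏ i, x i ^ ℓ i * Real.exp (-(x i) ^ 2) := by
  rw [EuclideanSpace.norm_sq_eq, Finset.prod_mul_distrib, ← Real.exp_sum, Finset.sum_neg_distrib]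
  simp [monom]

lemma monom_gauss_integrable {n : ℕ} (ℓ : Fin n → ℕ) :
    Integrable (fun y : EuclideanSpace ℝ (Fin n) => monom ℓ y * Real.exp (-‖y‖ ^ 2)) := by
  have := Integrable.fintype_prod (𝕜 := ℝ) (f := fun (i : Fin n) (v : ℝ) => v ^ ℓ i * Real.exp (-v ^ 2))
    (μ := fun _ => volume) (fun i => gm_integrable (ℓ i))
  rw [← (PiLp.volume_preserving_toLp (Fin n)).integrable_comp_emb
    (MeasurableEquiv.toLp 2 (Fin n → ℝ)).measurableEmbedding]
  refine this.congr (Eventually.of_forall fun x => ?_)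
  exact (monom_gauss_eq ℓ x).symm

lemma monom_gauss {n : ℕ} (ℓ : Fin n → ℕ) :
    ∫ y : EuclideanSpace ℝ (Fin n), monom ℓ y * Real.exp (-‖y‖ ^ 2) = GG ℓ := by
  rw [← (PiLp.volume_preserving_toLp (Fin n)).integral_comp
    (MeasurableEquiv.toLp 2 (Fin n → ℝ)).measurableEmbedding]
  simp_rw [monom_gauss_eq]
  rw [integral_fintype_prod_volume_eq_prod (f := fun i (v : ℝ) => v ^ ℓ i * Real.exp (-v ^ 2))]
  rfl

/-! Derivatives of monomials -/

def dn {n : ℕ} (k : ℕ) (i : Fin n) (ℓ : Fin n → ℕ) : Fin n → ℕ := Function.update ℓ i (ℓ i - k)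

lemma dn_dn {n : ℕ} (i : Fin n) (ℓ : Fin n → ℕ) : dn 1 i (dn 1 i ℓ) = dn 2 i ℓ := by
  unfold dn
  simp [Nat.sub_sub]

lemma monom_dn {n : ℕ} (k : ℕ) (i : Fin n) (ℓ : Fin n → ℕ) (x : EuclideanSpace ℝ (Fin n)) :
    monom (dn k i ℓ) x = x i ^ (ℓ i - k) * ∏ j ∈ Finset.univ.erase i, x j ^ ℓ j := by
  unfold monom
  rw [← Finset.mul_prod_erase Finset.univ _ (Finset.mem_univ i)]
  congr 1
  · simp [dn]
  · refine Finset.prod_congr rfl fun j hj => ?_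
    simp [dn, Function.update_of_ne (Finset.ne_of_mem_erase hj)]

lemma monom_hasFDerivAt {n : ℕ} (ℓ : Fin n → ℕ) (x : EuclideanSpace ℝ (Fin n)) :
    HasFDerivAt (monom ℓ) (∑ i : Fin n, (∏ j ∈ Finset.univ.erase i, x j ^ ℓ j) •
      ((ℓ i * x i ^ (ℓ i - 1) : ℝ) • (EuclideanSpace.proj i : EuclideanSpace ℝ (Fin n) →L[ℝ] ℝ))) x := by
  have h : ∀ i : Fin n, HasFDerivAt (fun y : EuclideanSpace ℝ (Fin n) => y i ^ ℓ i)
      ((ℓ i * x i ^ (ℓ i - 1) : ℝ) • (EuclideanSpace.proj i : EuclideanSpace ℝ (Fin n) →L[ℝ] ℝ)) x := by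
    intro i
    have h0 : HasFDerivAt (fun y : EuclideanSpace ℝ (Fin n) => y i)
      (EuclideanSpace.proj i : EuclideanSpace ℝ (Fin n) →L[ℝ] ℝ) x :=
      (EuclideanSpace.proj i : EuclideanSpace ℝ (Fin n) →L[ℝ] ℝ).hasFDerivAt
    exact (hasDerivAt_pow (ℓ i) (x i)).comp_hasFDerivAt x h0
  exact HasFDerivAt.finset_prod (u := Finset.univ) (fun i _ => h i)

lemma pd_comb {n : ℕ} {ι : Type} [Fintype ι] (c : ι → ℝ) (m : ι → Fin n → ℕ) (i : Fin n) :
    pd i (fun x => ∑ a, c a * monom (m a) x) = fun x => ∑ a, (c a * m a i) * monom (dn 1 i (m a)) x := by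
  funext x
  have h : HasFDerivAt (fun x => ∑ a, c a * monom (m a) x) _ x :=
    HasFDerivAt.fun_sum (u := Finset.univ) (fun a _ => (monom_hasFDerivAt (m a) x).const_mul (c a))
  unfold pd
  rw [h.fderiv]
  simp only [ContinuousLinearMap.sum_apply, ContinuousLinearMap.smul_apply, smul_eq_mul]
  refine Finset.sum_congr rfl fun a _ => ?_
  rw [monom_dn, Finset.sum_eq_single i]
  · simp
    ring
  · intro b _ hb
    simp [hb]
  · simp

lemma lap_comb {n : ℕ} {ι : Type} [Fintype ι] (c : ι → ℝ) (m : ι → Fin n → ℕ) :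
    lap n (fun x => ∑ a, c a * monom (m a) x) =
      fun x => ∑ q : Fin n × ι, (c q.2 * (m q.2 q.1 * (m q.2 q.1 - 1 : ℕ))) * monom (dn 2 q.1 (m q.2)) x := by
  funext x
  unfold lap
  rw [Fintype.sum_prod_type]
  refine Finset.sum_congr rfl fun i _ => ?_
  rw [pd_comb c m i, pd_comb _ (fun a => dn 1 i (m a)) i]
  refine Finset.sum_congr rfl fun a _ => ?_
  rw [dn_dn]
  simp only [dn, Function.update_self]
  ring

noncomputable def cc {n : ℕ} (ℓ : Fin n → ℕ) (i : Fin n) : ℝ := ℓ i * (ℓ i - 1 : ℕ)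

lemma laplap {n : ℕ} (ℓ : Fin n → ℕ) : lap n (lap n (monom ℓ)) =
    fun x => ∑ i : Fin n, ∑ j : Fin n, (cc ℓ i * cc (dn 2 i ℓ) j) * monom (dn 2 j (dn 2 i ℓ)) x := by
  have h0 : monom ℓ = fun x => ∑ a : Unit, (1 : ℝ) * monom ℓ x := by funext x; simp
  rw [h0, lap_comb (fun _ : Unit => (1 : ℝ)) (fun _ => ℓ), lap_comb]
  funext x
  rw [Fintype.sum_prod_type, Finset.sum_comm, Fintype.sum_prod_type]
  simp [cc]

lemma cc_deg {n : ℕ} (ℓ : Fin n → ℕ) (i : Fin n) :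
    cc ℓ i = 0 ∨ ∑ j, dn 2 i ℓ j + 2 = ∑ j, ℓ j := by
  by_cases h : 2 ≤ ℓ i
  · right
    rw [← Finset.add_sum_erase Finset.univ _ (Finset.mem_univ i),
      ← Finset.add_sum_erase Finset.univ ℓ (Finset.mem_univ i)]
    have : ∑ j ∈ Finset.univ.erase i, dn 2 i ℓ j = ∑ j ∈ Finset.univ.erase i, ℓ j := by
      refine Finset.sum_congr rfl fun j hj => ?_
      simp [dn, Function.update_of_ne (Finset.ne_of_mem_erase hj)]
    rw [this]
    simp only [dn, Function.update_self]
    omega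
  · left
    have : ℓ i = 0 ∨ ℓ i = 1 := by omega
    rcases this with h | h <;> simp [cc, h]

lemma cc_GG {n : ℕ} (ℓ : Fin n → ℕ) (i : Fin n) : cc ℓ i * GG (dn 2 i ℓ) = 2 * ℓ i * GG ℓ := by
  unfold GG
  rw [← Finset.mul_prod_erase Finset.univ _ (Finset.mem_univ i),
      ← Finset.mul_prod_erase Finset.univ (fun i => gm (ℓ i)) (Finset.mem_univ i)]
  have : ∏ j ∈ Finset.univ.erase i, gm (dn 2 i ℓ j) = ∏ j ∈ Finset.univ.erase i, gm (ℓ j) := by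
    refine Finset.prod_congr rfl fun j hj => ?_
    simp [dn, Function.update_of_ne (Finset.ne_of_mem_erase hj)]
  rw [this]
  simp only [dn, Function.update_self]
  unfold cc
  rcases Nat.lt_or_ge (ℓ i) 2 with h | h
  · have : ℓ i = 0 ∨ ℓ i = 1 := by omega
    rcases this with h | h
    · simp [h]
    · simp [h, gm_odd (show Odd 1 by decide)]
  · obtain ⟨k, hk⟩ := Nat.exists_eq_add_of_le h
    have e := gm_rec k
    rw [hk, show 2 + k - 2 = k by omega, show 2 + k - 1 = k + 1 by omega, show 2 + k = k + 2 by ring]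
    push_cast
    linear_combination (-(k + 2 : ℝ) * ∏ j ∈ Finset.univ.erase i, gm (ℓ j)) * e

lemma monom_hom {n : ℕ} (ℓ : Fin n → ℕ) (r : ℝ) (x : EuclideanSpace ℝ (Fin n)) :
    monom ℓ (r • x) = r ^ (∑ i, ℓ i) * monom ℓ x := by
  unfold monom
  simp [mul_pow, Finset.prod_mul_distrib, Finset.prod_pow_eq_pow_sum]

lemma laplap_coef {n : ℕ} (ℓ : Fin n → ℕ) (i j : Fin n) :
    cc ℓ i * cc (dn 2 i ℓ) j = 0 ∨ ∑ k, dn 2 j (dn 2 i ℓ) k + 4 = ∑ k, ℓ k := by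
  rcases cc_deg ℓ i with h | h
  · left; simp [h]
  rcases cc_deg (dn 2 i ℓ) j with h' | h'
  · left; simp [h']
  right; omega

lemma laplap_hom {n : ℕ} (ℓ : Fin n → ℕ) (M : ℕ) (hM : ∑ i, ℓ i = M + 4) (r : ℝ)
    (x : EuclideanSpace ℝ (Fin n)) :
    lap n (lap n (monom ℓ)) (r • x) = r ^ M * lap n (lap n (monom ℓ)) x := by
  rw [laplap]
  simp only
  rw [Finset.mul_sum]
  refine Finset.sum_congr rfl fun i _ => ?_
  rw [Finset.mul_sum]
  refine Finset.sum_congr rfl fun j _ => ?_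
  rcases laplap_coef ℓ i j with h | h
  · simp [h]
  · rw [monom_hom, show ∑ k, dn 2 j (dn 2 i ℓ) k = M by omega]
    ring

lemma laplap_zero {n : ℕ} (ℓ : Fin n → ℕ) (hM : ∑ i, ℓ i < 4) (x : EuclideanSpace ℝ (Fin n)) :
    lap n (lap n (monom ℓ)) x = 0 := by
  rw [laplap]
  refine Finset.sum_eq_zero fun i _ => Finset.sum_eq_zero fun j _ => ?_
  rcases laplap_coef ℓ i j with h | h
  · simp [h]
  · omega

lemma laplap_gauss {n : ℕ} (ℓ : Fin n → ℕ) (M : ℕ) (hM : ∑ i, ℓ i = M + 4) :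
    ∫ y : EuclideanSpace ℝ (Fin n), lap n (lap n (monom ℓ)) y * Real.exp (-‖y‖ ^ 2)
      = 4 * (M + 4) * (M + 2) * GG ℓ := by
  have hint : ∀ i j : Fin n, Integrable (fun y : EuclideanSpace ℝ (Fin n) =>
      (cc ℓ i * cc (dn 2 i ℓ) j) * (monom (dn 2 j (dn 2 i ℓ)) y * Real.exp (-‖y‖ ^ 2))) :=
    fun i j => (monom_gauss_integrable _).const_mul _
  rw [laplap]
  simp only [Finset.sum_mul, mul_assoc (cc _ _ * cc _ _)]
  rw [integral_finset_sum _ (fun i _ => integrable_finset_sum _ (fun j _ => hint i j))]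
  have e : ∀ i : Fin n, ∫ y : EuclideanSpace ℝ (Fin n), ∑ j : Fin n,
      (cc ℓ i * cc (dn 2 i ℓ) j) * (monom (dn 2 j (dn 2 i ℓ)) y * Real.exp (-‖y‖ ^ 2))
      = ℓ i * (4 * (M + 2) * GG ℓ) := by
    intro i
    rw [integral_finset_sum _ (fun j _ => hint i j)]
    have : ∀ j : Fin n, ∫ y : EuclideanSpace ℝ (Fin n),
      (cc ℓ i * cc (dn 2 i ℓ) j) * (monom (dn 2 j (dn 2 i ℓ)) y * Real.exp (-‖y‖ ^ 2))
        = (dn 2 i ℓ j : ℝ) * (2 * (cc ℓ i * GG (dn 2 i ℓ))) := by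
      intro j
      rw [integral_const_mul, monom_gauss, mul_assoc, cc_GG]
      ring
    simp_rw [this]
    rw [← Finset.sum_mul]
    rcases cc_deg ℓ i with h | h
    · have h2 := cc_GG ℓ i
      rw [h, zero_mul] at *
      linear_combination (-2 * ((M : ℝ) + 2)) * -h2
    · have : (∑ j, (dn 2 i ℓ j : ℝ)) = M + 2 := by
        have : ∑ j, dn 2 i ℓ j = M + 2 := by omega
        exact_mod_cast this
      rw [this, cc_GG]
      ring
  simp_rw [e]
  rw [← Finset.sum_mul]
  have : (∑ j, (ℓ j : ℝ)) = M + 4 := by exact_mod_cast hM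
  rw [this]
  ring

lemma GG_odd {n : ℕ} (ℓ : Fin n → ℕ) (h : ∃ i, Odd (ℓ i)) : GG ℓ = 0 := by
  obtain ⟨i, hi⟩ := h
  exact Finset.prod_eq_zero (Finset.mem_univ i) (gm_odd hi)

lemma GG_even {n : ℕ} (ℓ : Fin n → ℕ) (h : ∀ i, Even (ℓ i)) : 0 < GG ℓ :=
  Finset.prod_pos fun i _ => gm_even (h i)

lemma RR_zero_mod (d k : ℕ) : RR d (4 * k + 2) = 0 := by
  induction k with
  | zero => exact RR_two d
  | succ k ih => rw [show 4 * (k + 1) + 2 = 4 * k + 2 + 4 by ring, RR_rec, ih, mul_zero]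

lemma RR_sign (d k : ℕ) (h0 : 0 < RR d 0) : 0 < RR d (8 * k) ∧ RR d (8 * k + 4) < 0 := by
  have step1 : ∀ N, 0 < RR d N → RR d (N + 4) < 0 := by
    intro N hN
    rw [RR_rec, neg_mul, neg_lt_zero]
    positivity
  have step2 : ∀ N, RR d N < 0 → 0 < RR d (N + 4) := by
    intro N hN
    rw [RR_rec, neg_mul, ← mul_neg]
    have : 0 < -RR d N := by linarith
    positivity
  induction k with
  | zero => exact ⟨h0, step1 _ h0⟩
  | succ k ih =>
    have := step2 _ ih.2
    have e : 8 * (k + 1) = 8 * k + 4 + 4 := by ring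
    rw [← e] at this
    exact ⟨this, step1 _ this⟩

lemma main_aux (d : ℕ)
    (α : ℝ) (hα : 0 < α)
    (hαdef : α⁻¹ = ∫ x : EuclideanSpace ℝ (Fin (d + 1)), fmn 2 (d + 1) ‖x‖)
    (ℓ : Fin (d + 1) → ℕ) :
    ∃ c : ℝ, 0 < c ∧ 0 < RR d 0 ∧
    (∫ y : EuclideanSpace ℝ (Fin (d + 1)), monom ℓ y * vinf (d + 1) α y)
      = c * (GG ℓ * RR d (∑ i, ℓ i)) ∧
    (∫ y : EuclideanSpace ℝ (Fin (d + 1)), lap (d + 1) (lap (d + 1) (monom ℓ)) y * vinf (d + 1) α y)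
      = -(∑ i, ℓ i : ℝ) * (c * (GG ℓ * RR d (∑ i, ℓ i))) := by
  set N := ∑ i, ℓ i with hN
  have hNc : (∑ i, ℓ i : ℝ) = N := by rw [hN]; push_cast; rfl
  -- positivity of the zeroth radial moment
  have hR0 : 0 < RR d 0 := by
    have hp := polar d 0 (fun _ => 1) (by simp) (fmn 2 (d + 1))
    simp only [one_mul] at hp
    rw [← hαdef, fmn_moment] at hp
    have h1 : 0 < α⁻¹ := by positivity
    rw [hp] at h1
    refine pos_of_mul_pos_right h1 ?_
    exact integral_nonneg fun _ => zero_le_one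
  set A : ℝ := 2 ^ (((d + 1 : ℕ) : ℝ) / 2) * α with hA
  have hApos : 0 < A := by positivity
  set w : ℝ := (Real.sqrt 2)⁻¹ with hw
  have hwpos : 0 < w := by positivity
  have hw2 : w ^ 2 = 1 / 2 := by
    rw [hw, inv_pow, Real.sq_sqrt (by norm_num)]; norm_num
  have hw4 : w ^ 4 = 1 / 4 := by
    rw [show (4 : ℕ) = 2 * 2 by norm_num, pow_mul, hw2]; norm_num
  have pv := fun (M : ℕ) (P : EuclideanSpace ℝ (Fin (d + 1)) → ℝ)
    (hP : ∀ (r : ℝ) x, P (r • x) = r ^ M * P x) =>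
    polar d M P hP (fun r => 2 ^ (((d + 1 : ℕ) : ℝ) / 2) * α * fmn 2 (d + 1) (Real.sqrt 2 * r))
  have pg := fun (M : ℕ) (P : EuclideanSpace ℝ (Fin (d + 1)) → ℝ)
    (hP : ∀ (r : ℝ) x, P (r • x) = r ^ M * P x) =>
    polar d M P hP (fun r => Real.exp (-r ^ 2))
  have m1 := pv N (monom ℓ) (fun r x => monom_hom ℓ r x)
  have m2 := pg N (monom ℓ) (fun r x => monom_hom ℓ r x)
  rw [fmn_moment_scaled] at m1
  rw [monom_gauss] at m2
  change GG ℓ = _ * rg (d + N) at m2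
  have hrg := rg_pos (d + N)
  set σ := ∫ ω : Metric.sphere (0 : EuclideanSpace ℝ (Fin (d + 1))) 1, monom ℓ ω
        ∂(volume : Measure (EuclideanSpace ℝ (Fin (d + 1)))).toSphere with hσ
  have hc : (∫ y : EuclideanSpace ℝ (Fin (d + 1)), monom ℓ y * vinf (d + 1) α y)
      = (A * w ^ (d + N + 1) / rg (d + N)) * (GG ℓ * RR d N) := by
    unfold vinf
    rw [m1, m2, ← hA, ← hw]
    field_simp
  refine ⟨A * w ^ (d + N + 1) / rg (d + N), by positivity, hR0, hc, ?_⟩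
  rw [hNc]
  rcases Nat.lt_or_ge N 4 with h4 | h4
  · have : ∀ y, lap (d + 1) (lap (d + 1) (monom ℓ)) y = 0 := laplap_zero ℓ h4
    simp only [this, zero_mul, integral_zero]
    by_cases hodd : ∃ i, Odd (ℓ i)
    · rw [GG_odd ℓ hodd]; ring
    · have hev : Even N := by
        rw [hN]
        refine Finset.even_sum _ (fun i _ => ?_)
        rw [← Nat.not_odd_iff_even]
        exact fun h => hodd ⟨i, h⟩
      have : N = 0 ∨ N = 2 := by
        obtain ⟨k, hk⟩ := hev
        omega
      rcases this with h | h
      · rw [h]; simp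
      · rw [h, RR_two]; ring
  · obtain ⟨M, hM⟩ := Nat.exists_eq_add_of_le h4
    rw [add_comm] at hM
    have l1 := pv M _ (fun r x => laplap_hom ℓ M (hN.symm.trans hM) r x)
    have l2 := pg M _ (fun r x => laplap_hom ℓ M (hN.symm.trans hM) r x)
    rw [fmn_moment_scaled] at l1
    rw [laplap_gauss ℓ M (hN.symm.trans hM)] at l2
    change _ = _ * rg (d + M) at l2
    have hrgM := rg_pos (d + M)
    unfold vinf
    rw [l1, ← hA, ← hw]
    set τ := ∫ ω : Metric.sphere (0 : EuclideanSpace ℝ (Fin (d + 1))) 1,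
      lap (d + 1) (lap (d + 1) (monom ℓ)) ω
        ∂(volume : Measure (EuclideanSpace ℝ (Fin (d + 1)))).toSphere with hτ
    have hτ2 : τ = 4 * (M + 4) * (M + 2) * GG ℓ / rg (d + M) := by
      rw [l2]; field_simp
    have r1 := rg_rec (d + M)
    have r2 := rg_rec (d + M + 2)
    have r3 : rg (d + N) = ((d + M + 3) * (d + M + 1) / 4) * rg (d + M) := by
      rw [hM, show d + (M + 4) = d + M + 2 + 2 by ring]
      push_cast at r1 r2
      linear_combination r2 / 2 + ((d : ℝ) + M + 3) / 4 * r1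
    rw [hτ2, r3, hM, RR_rec, show d + (M + 4) + 1 = d + M + 1 + 4 by ring, pow_add w (d + M + 1) 4, hw4]
    have p1 : (0 : ℝ) < d + M + 3 := by positivity
    have p2 : (0 : ℝ) < d + M + 1 := by positivity
    push_cast
    field_simp

/-- signs of the monomial moments `M_{P_ℓ} = ∫ P_ℓ v_∞` of the rescaled
biharmonic heat kernel. -/
theorem vinf_monomial_moments (n : ℕ) (hn : 1 ≤ n)
    (α : ℝ) (hα : 0 < α)
    (hαdef : α⁻¹ = ∫ x : EuclideanSpace ℝ (Fin n), fmn 2 n ‖x‖)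
    (ℓ : Fin n → ℕ) :
    (∫ y : EuclideanSpace ℝ (Fin n), lap n (lap n (monom ℓ)) y * vinf n α y)
        = -(∑ i : Fin n, ℓ i : ℝ) *
          ∫ y : EuclideanSpace ℝ (Fin n), monom ℓ y * vinf n α y ∧
    ((¬ (4 ∣ ∑ i : Fin n, ℓ i) ∨ ∃ i : Fin n, Odd (ℓ i)) →
      (∫ y : EuclideanSpace ℝ (Fin n), monom ℓ y * vinf n α y) = 0) ∧
    ((8 ∣ ∑ i : Fin n, ℓ i) → (∀ i : Fin n, Even (ℓ i)) →
      0 < ∫ y : EuclideanSpace ℝ (Fin n), monom ℓ y * vinf n α y) ∧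
    ((∑ i : Fin n, ℓ i) % 8 = 4 → (∀ i : Fin n, Even (ℓ i)) →
      (∫ y : EuclideanSpace ℝ (Fin n), monom ℓ y * vinf n α y) < 0) := by
  obtain ⟨d, rfl⟩ : ∃ d, n = d + 1 := ⟨n - 1, by omega⟩
  obtain ⟨c, hc, hR0, h1, h2⟩ := main_aux d α hα hαdef ℓ
  refine ⟨?_, ?_, ?_, ?_⟩
  · rw [h2, h1]
  · intro h
    rw [h1]
    by_cases hodd : ∃ i, Odd (ℓ i)
    · rw [GG_odd ℓ hodd]; ring
    · have h4 := h.resolve_right hodd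
      have hev : Even (∑ i, ℓ i) := by
        refine Finset.even_sum _ (fun i _ => ?_)
        rw [← Nat.not_odd_iff_even]
        exact fun h => hodd ⟨i, h⟩
      obtain ⟨k, hk⟩ := hev
      have : ∑ i, ℓ i = 4 * ((∑ i, ℓ i) / 4) + 2 := by omega
      rw [this, RR_zero_mod]
      ring
  · rintro ⟨k, hk⟩ hev
    rw [h1, hk]
    have := (RR_sign d k hR0).1
    have := GG_even ℓ hev
    positivity
  · intro hk hev
    have e : ∑ i, ℓ i = 8 * ((∑ i, ℓ i) / 8) + 4 := by omega
    rw [h1, e]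
    have a := (RR_sign d ((∑ i, ℓ i) / 8) hR0).2
    have b := GG_even ℓ hev
    have : GG ℓ * RR d (8 * ((∑ i, ℓ i) / 8) + 4) < 0 := mul_neg_of_pos_of_neg b a
    exact mul_neg_of_pos_of_neg hc this
end
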